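/- arXiv:2001.11237 — 7 statements merged into one kernel-verified Lean document; each statement's English description precedes it below -/
import Mathlib

section
/- The set CVENN of bipartite states with non-negative conditional von Neumann entropy is convex: if σ₁ and σ₂ are states on ℂ^d ⊗ ℂ^d with S_{A|B}(σ₁) ≥ 0 and S_{A|B}(σ₂) ≥ 0, and λ ∈ [0,1], then the state σ = λ·σ₁ + (1−λ)·σ₂ satisfies S_{A|B}(σ) ≥ 0. -/
open scoped Kronecker ComplexOrder
open Matrix

noncomputable section

/-- Base-2 matrix logarithm via the functional calculus: same eigenvectors, eigenvalues
replaced by their base-2 logarithms (junk value `0` on non-Hermitian matrices). -/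
def matLog2 {n : Type*} [Fintype n] [DecidableEq n] (M : Matrix n n ℂ) : Matrix n n ℂ :=
  if h : M.IsHermitian then
    (h.eigenvectorUnitary : Matrix n n ℂ) *
      Matrix.diagonal (fun i => (Real.logb 2 (h.eigenvalues i) : ℂ)) *
      (star (h.eigenvectorUnitary : Matrix n n ℂ))
  else 0

/-- von Neumann entropy `S(M) = −∑ λᵢ log₂ λᵢ` over the eigenvalues of `M`
(the convention `0 · log₂ 0 = 0` holds since `Real.logb 2 0 = 0`). -/
def vnEntropy {n : Type*} [Fintype n] [DecidableEq n] (M : Matrix n n ℂ) : ℝ :=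
  if h : M.IsHermitian then -∑ i, h.eigenvalues i * Real.logb 2 (h.eigenvalues i) else 0

/-- Partial trace over the first subsystem: `(ρ_B)_{k,l} = ∑ i, ρ_{(i,k),(i,l)}`. -/
def ptraceB {d : ℕ} (ρ : Matrix (Fin d × Fin d) (Fin d × Fin d) ℂ) : Matrix (Fin d) (Fin d) ℂ :=
  Matrix.of fun k l => ∑ i, ρ (i, k) (i, l)

/-- Partial trace over the second subsystem: `(ρ_A)_{i,j} = ∑ k, ρ_{(i,k),(j,k)}`. -/
def ptraceA {d : ℕ} (ρ : Matrix (Fin d × Fin d) (Fin d × Fin d) ℂ) : Matrix (Fin d) (Fin d) ℂ :=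
  Matrix.of fun i j => ∑ k, ρ (i, k) (j, k)

/-- Conditional von Neumann entropy `S_{A|B}(ρ) = S(ρ) − S(ρ_B)`. -/
def condEntropy {d : ℕ} (ρ : Matrix (Fin d × Fin d) (Fin d × Fin d) ℂ) : ℝ :=
  vnEntropy ρ - vnEntropy (ptraceB ρ)

/-- A state on `ℂ^d ⊗ ℂ^d`: a positive semidefinite matrix with trace 1. -/
def IsState {d : ℕ} (ρ : Matrix (Fin d × Fin d) (Fin d × Fin d) ℂ) : Prop :=
  ρ.PosSemidef ∧ ρ.trace = 1

open Filter Topology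

/-- `A = U diag(a) U*` with `U` unitary and `a` real. -/
structure IsSpectralDecomp {n : Type*} [Fintype n] [DecidableEq n]
    (A U : Matrix n n ℂ) (a : n → ℝ) : Prop where
  star_mul_self : Uᴴ * U = 1
  eq : A = U * diagonal (fun i => (a i : ℂ)) * Uᴴ

namespace IsSpectralDecomp

variable {n : Type*} [Fintype n] [DecidableEq n] {A B U V : Matrix n n ℂ} {a b : n → ℝ}

theorem mul_star_self (h : IsSpectralDecomp A U a) : U * Uᴴ = 1 :=
  mul_eq_one_comm.mp h.star_mul_self

theorem star_mul_mul (h : IsSpectralDecomp A U a) :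
    Uᴴ * A * U = diagonal (fun i => (a i : ℂ)) := by
  rw [h.eq]
  calc Uᴴ * (U * diagonal (fun i => (a i : ℂ)) * Uᴴ) * U
      = (Uᴴ * U) * diagonal (fun i => (a i : ℂ)) * (Uᴴ * U) := by simp only [Matrix.mul_assoc]
    _ = _ := by rw [h.star_mul_self, Matrix.one_mul, Matrix.mul_one]

theorem add_smul_one (h : IsSpectralDecomp A U a) (ε : ℝ) :
    IsSpectralDecomp (A + (ε : ℂ) • 1) U (fun i => a i + ε) where
  star_mul_self := h.star_mul_self
  eq := by
    have : diagonal (fun i => ((a i + ε : ℝ) : ℂ))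
        = diagonal (fun i => (a i : ℂ)) + (ε : ℂ) • (1 : Matrix n n ℂ) := by
      ext i j
      by_cases hij : i = j <;> simp [hij, diagonal]
    rw [this, Matrix.mul_add, Matrix.add_mul, ← h.eq, Matrix.mul_smul, Matrix.smul_mul,
      Matrix.mul_one, h.mul_star_self]

theorem of_isHermitian (h : A.IsHermitian) :
    IsSpectralDecomp A (h.eigenvectorUnitary : Matrix n n ℂ) h.eigenvalues where
  star_mul_self := by
    simpa [star_eq_conjTranspose] using Unitary.coe_star_mul_self h.eigenvectorUnitary
  eq := by
    conv_lhs => rw [h.spectral_theorem]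
    simp [Unitary.conjStarAlgAut_apply, star_eq_conjTranspose, Function.comp_def]

end IsSpectralDecomp

section

variable {n : Type*} [Fintype n]

/-- The transition weight between the `i`-th column of `U` and the `j`-th column of `V`. -/
def overlap (U V : Matrix n n ℂ) (i j : n) : ℝ := Complex.normSq ((Vᴴ * U) j i)

/-- A functional, affine in `(A, B)`, whose supremum over `X` is a resolvent quadratic form. -/
def resolventFunctional (t : ℝ) (A B X : Matrix n n ℂ) : ℝ :=
  (2 * (Xᴴ * A).trace - (Xᴴ * B * X).trace - (t : ℂ) * (X * A * Xᴴ).trace).re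

theorem resolventFunctional_combo (t l m : ℝ) (A₁ A₂ B₁ B₂ X : Matrix n n ℂ) :
    resolventFunctional t ((l : ℂ) • A₁ + (m : ℂ) • A₂) ((l : ℂ) • B₁ + (m : ℂ) • B₂) X
      = l * resolventFunctional t A₁ B₁ X + m * resolventFunctional t A₂ B₂ X := by
  simp only [resolventFunctional, Matrix.mul_add, Matrix.add_mul, Matrix.mul_smul,
    Matrix.smul_mul, trace_add, trace_smul, smul_eq_mul, ← Complex.re_ofReal_mul,
    ← Complex.add_re]
  congr 1
  ring

/-- Spectral form of the resolvent quadratic form `⟨A, (L_B + t R_A)⁻¹ A⟩`. -/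
def resolventForm (t : ℝ) (U V : Matrix n n ℂ) (a b : n → ℝ) : ℝ :=
  ∑ i, ∑ j, overlap U V i j * (a i * (a i / (b j + t * a i)))

/-- Spectral form of the relative entropy `tr A (log A - log B)`. -/
def spectralRelEntropy (U V : Matrix n n ℂ) (a b : n → ℝ) : ℝ :=
  ∑ i, ∑ j, overlap U V i j * (a i * (Real.log (a i) - Real.log (b j)))

/-- The integral of `resolventForm` over `[0, T]`. -/
def integratedForm (T : ℝ) (U V : Matrix n n ℂ) (a b : n → ℝ) : ℝ :=
  ∑ i, ∑ j, overlap U V i j * (a i * (Real.log (b j + T * a i) - Real.log (b j)))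

variable {U V : Matrix n n ℂ} {a b : n → ℝ}

theorem hasDerivAt_integratedForm (ha : ∀ i, 0 ≤ a i) (hb : ∀ j, 0 < b j) {t : ℝ}
    (ht : 0 ≤ t) :
    HasDerivAt (fun T => integratedForm T U V a b) (resolventForm t U V a b) t := by
  unfold integratedForm resolventForm
  refine HasDerivAt.fun_sum fun i _ => HasDerivAt.fun_sum fun j _ => ?_
  have hc : b j + t * a i ≠ 0 :=
    (add_pos_of_pos_of_nonneg (hb j) (mul_nonneg ht (ha i))).ne'
  have h1 : HasDerivAt (fun T => b j + T * a i) (a i) t := by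
    simpa using ((hasDerivAt_id t).mul_const (a i)).const_add (b j)
  exact (((h1.log hc).sub_const _).const_mul _).const_mul _

variable [DecidableEq n] {A B : Matrix n n ℂ}

theorem resolventFunctional_conj (hA : IsSpectralDecomp A U a) (hB : IsSpectralDecomp B V b)
    (t : ℝ) (Y : Matrix n n ℂ) :
    resolventFunctional t A B (V * Y * Uᴴ)
      = ∑ i, ∑ j, (2 * a i * (star (Y j i) * (Vᴴ * U) j i).re
          - (b j + t * a i) * Complex.normSq (Y j i)) := by
  have hXs : (V * Y * Uᴴ)ᴴ = U * Yᴴ * Vᴴ := by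
    simp [conjTranspose_mul, Matrix.mul_assoc]
  have e1 : ((V * Y * Uᴴ)ᴴ * A).trace
      = (Yᴴ * (Vᴴ * U) * diagonal (fun i => (a i : ℂ))).trace := by
    rw [hXs, hA.eq]
    calc (U * Yᴴ * Vᴴ * (U * diagonal (fun i => (a i : ℂ)) * Uᴴ)).trace
        = (U * (Yᴴ * (Vᴴ * U) * diagonal (fun i => (a i : ℂ)) * Uᴴ)).trace := by
          simp only [Matrix.mul_assoc]
      _ = _ := by
          rw [trace_mul_comm, Matrix.mul_assoc, hA.star_mul_self, Matrix.mul_one]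
  have e2 : ((V * Y * Uᴴ)ᴴ * B * (V * Y * Uᴴ)).trace
      = (Yᴴ * diagonal (fun i => (b i : ℂ)) * Y).trace := by
    rw [hXs]
    calc (U * Yᴴ * Vᴴ * B * (V * Y * Uᴴ)).trace
        = (U * (Yᴴ * (Vᴴ * B * V) * Y * Uᴴ)).trace := by simp only [Matrix.mul_assoc]
      _ = _ := by
          rw [trace_mul_comm, Matrix.mul_assoc, hA.star_mul_self, Matrix.mul_one,
            hB.star_mul_mul]
  have e3 : (V * Y * Uᴴ * A * (V * Y * Uᴴ)ᴴ).trace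
      = (Y * diagonal (fun i => (a i : ℂ)) * Yᴴ).trace := by
    rw [hXs]
    calc (V * Y * Uᴴ * A * (U * Yᴴ * Vᴴ)).trace
        = (V * (Y * (Uᴴ * A * U) * Yᴴ * Vᴴ)).trace := by simp only [Matrix.mul_assoc]
      _ = _ := by
          rw [trace_mul_comm, Matrix.mul_assoc, hB.star_mul_self, Matrix.mul_one,
            hA.star_mul_mul]
  have f1 : (Yᴴ * (Vᴴ * U) * diagonal (fun i => (a i : ℂ))).trace
      = ∑ i, ∑ j, star (Y j i) * (Vᴴ * U) j i * a i := by
    simp only [trace, diag_apply, mul_diagonal]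
    simp only [Matrix.mul_apply (M := Yᴴ), conjTranspose_apply, Finset.sum_mul]
  have f2 : (Yᴴ * diagonal (fun i => (b i : ℂ)) * Y).trace
      = ∑ i, ∑ j, ((b j * Complex.normSq (Y j i) : ℝ) : ℂ) := by
    simp only [trace, diag_apply, Matrix.mul_apply (N := Y), mul_diagonal, conjTranspose_apply]
    refine Finset.sum_congr rfl fun i _ => Finset.sum_congr rfl fun j _ => ?_
    push_cast
    rw [← Complex.mul_conj, Complex.star_def]
    ring
  have f3 : (Y * diagonal (fun i => (a i : ℂ)) * Yᴴ).trace
      = ∑ i, ∑ j, ((a i * Complex.normSq (Y j i) : ℝ) : ℂ) := by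
    simp only [trace, diag_apply, Matrix.mul_apply (N := Yᴴ), mul_diagonal, conjTranspose_apply]
    rw [Finset.sum_comm]
    refine Finset.sum_congr rfl fun i _ => Finset.sum_congr rfl fun j _ => ?_
    push_cast
    rw [← Complex.mul_conj, Complex.star_def]
    ring
  rw [resolventFunctional, e1, e2, e3, f1, f2, f3]
  simp only [Finset.mul_sum, ← Finset.sum_sub_distrib, Complex.re_sum]
  refine Finset.sum_congr rfl fun i _ => Finset.sum_congr rfl fun j _ => ?_
  simp only [Complex.sub_re, Complex.ofReal_re, Complex.re_mul_ofReal]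
  rw [show (2 : ℂ) = ((2 : ℝ) : ℂ) by norm_num, Complex.re_ofReal_mul, Complex.re_mul_ofReal]
  ring

theorem resolventFunctional_le (hA : IsSpectralDecomp A U a) (hB : IsSpectralDecomp B V b)
    (ha : ∀ i, 0 ≤ a i) (hb : ∀ j, 0 < b j) {t : ℝ} (ht : 0 ≤ t) (X : Matrix n n ℂ) :
    resolventFunctional t A B X ≤ resolventForm t U V a b := by
  have hX : X = V * (Vᴴ * X * U) * Uᴴ := by
    calc X = (V * Vᴴ) * X * (U * Uᴴ) := by
          rw [hA.mul_star_self, hB.mul_star_self, Matrix.one_mul, Matrix.mul_one]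
      _ = _ := by simp only [Matrix.mul_assoc]
  rw [hX, resolventFunctional_conj hA hB]
  refine Finset.sum_le_sum fun i _ => Finset.sum_le_sum fun j _ => ?_
  have hc : 0 < b j + t * a i := add_pos_of_pos_of_nonneg (hb j) (mul_nonneg ht (ha i))
  generalize (Vᴴ * X * U) j i = y
  rw [overlap]
  generalize (Vᴴ * U) j i = w
  rw [← mul_div_assoc, ← mul_div_assoc, le_div_iff₀ hc]
  simp only [Complex.normSq_apply, Complex.star_def, Complex.mul_re, Complex.conj_re,
    Complex.conj_im]
  nlinarith [sq_nonneg ((b j + t * a i) * y.re - a i * w.re),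
    sq_nonneg ((b j + t * a i) * y.im - a i * w.im)]

theorem exists_resolventFunctional_eq (hA : IsSpectralDecomp A U a)
    (hB : IsSpectralDecomp B V b) (ha : ∀ i, 0 ≤ a i) (hb : ∀ j, 0 < b j) {t : ℝ}
    (ht : 0 ≤ t) :
    ∃ X, resolventFunctional t A B X = resolventForm t U V a b := by
  refine ⟨V * (Matrix.of fun j i => ((a i / (b j + t * a i) : ℝ) : ℂ) * (Vᴴ * U) j i) * Uᴴ, ?_⟩
  rw [resolventFunctional_conj hA hB]
  refine Finset.sum_congr rfl fun i _ => Finset.sum_congr rfl fun j _ => ?_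
  have hr : a i / (b j + t * a i) * (b j + t * a i) = a i :=
    div_mul_cancel₀ _ (add_pos_of_pos_of_nonneg (hb j) (mul_nonneg ht (ha i))).ne'
  rw [overlap, of_apply]
  generalize (Vᴴ * U) j i = w
  generalize a i / (b j + t * a i) = r at hr ⊢
  simp only [Complex.normSq_apply, Complex.star_def, Complex.mul_re, Complex.mul_im,
    Complex.conj_re, Complex.conj_im, Complex.ofReal_re, Complex.ofReal_im]
  linear_combination -(r * (w.re * w.re + w.im * w.im)) * hr

theorem tendsto_log_add_mul_sub_log {x y : ℝ} (hx : 0 ≤ x) (hy : 0 < y) :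
    Tendsto (fun T : ℝ => x * (Real.log (y + T * x) - Real.log y) - x * Real.log (1 + T)) atTop
      (𝓝 (x * (Real.log x - Real.log y))) := by
  rcases hx.eq_or_lt with rfl | hx
  · simp
  have hlim : Tendsto (fun T : ℝ => x + (y - x) / (1 + T)) atTop (𝓝 x) := by
    have : Tendsto (fun T : ℝ => (y - x) / (1 + T)) atTop (𝓝 0) :=
      tendsto_const_nhds.div_atTop (tendsto_atTop_add_const_left _ _ tendsto_id)
    simpa using this.const_add x
  have h2 := (((hlim.log hx.ne').sub_const (Real.log y)).const_mul x)
  refine h2.congr' ?_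
  filter_upwards [eventually_ge_atTop 0] with T hT
  have hT1 : 0 < 1 + T := by linarith
  have : x + (y - x) / (1 + T) = (y + T * x) / (1 + T) := by field_simp; ring
  rw [this, Real.log_div (by positivity) hT1.ne']
  ring

theorem sum_overlap_left (hA : IsSpectralDecomp A U a) (V : Matrix n n ℂ) (j : n) :
    ∑ i, overlap U V i j * a i = ((Vᴴ * A * V) j j).re := by
  have : Vᴴ * A * V = (Vᴴ * U) * diagonal (fun i => (a i : ℂ)) * (Vᴴ * U)ᴴ := by
    rw [hA.eq, conjTranspose_mul, conjTranspose_conjTranspose]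
    simp only [Matrix.mul_assoc]
  rw [this]
  simp only [Matrix.mul_apply (N := (Vᴴ * U)ᴴ), mul_diagonal, conjTranspose_apply,
    Complex.re_sum, overlap]
  refine Finset.sum_congr rfl fun i _ => ?_
  generalize (Vᴴ * U) j i = w
  simp [Complex.normSq_apply]
  ring

theorem sum_overlap_right (hU : Uᴴ * U = 1) (hV : V * Vᴴ = 1) (i : n) :
    ∑ j, overlap U V i j = 1 := by
  have h : (Vᴴ * U)ᴴ * (Vᴴ * U) = 1 := by
    rw [conjTranspose_mul, conjTranspose_conjTranspose]
    calc Uᴴ * V * (Vᴴ * U) = Uᴴ * (V * Vᴴ) * U := by simp only [Matrix.mul_assoc]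
      _ = 1 := by rw [hV, Matrix.mul_one, hU]
  have h2 := congrArg Complex.re (congrFun (congrFun h i) i)
  rw [Matrix.mul_apply, Complex.re_sum, one_apply_eq, Complex.one_re] at h2
  rw [← h2]
  refine Finset.sum_congr rfl fun j _ => ?_
  rw [overlap, conjTranspose_apply]
  generalize (Vᴴ * U) j i = w
  simp [Complex.normSq_apply]

theorem sum_sum_overlap (hA : IsSpectralDecomp A U a) (hB : IsSpectralDecomp B V b) :
    ∑ i, ∑ j, overlap U V i j * a i = A.trace.re := by
  simp only [← Finset.sum_mul, sum_overlap_right hA.star_mul_self hB.mul_star_self, one_mul]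
  rw [hA.eq, trace_mul_comm, ← Matrix.mul_assoc, hA.star_mul_self, Matrix.one_mul,
    trace_diagonal, Complex.re_sum]
  simp

theorem tendsto_integratedForm (hA : IsSpectralDecomp A U a) (hB : IsSpectralDecomp B V b)
    (ha : ∀ i, 0 ≤ a i) (hb : ∀ j, 0 < b j) :
    Tendsto (fun T => integratedForm T U V a b - A.trace.re * Real.log (1 + T)) atTop
      (𝓝 (spectralRelEntropy U V a b)) := by
  have h : ∀ T, integratedForm T U V a b - A.trace.re * Real.log (1 + T)
      = ∑ i, ∑ j, overlap U V i j *
        (a i * (Real.log (b j + T * a i) - Real.log (b j)) - a i * Real.log (1 + T)) := by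
    intro T
    rw [← sum_sum_overlap hA hB, integratedForm]
    simp only [Finset.sum_mul, ← Finset.sum_sub_distrib]
    refine Finset.sum_congr rfl fun i _ => Finset.sum_congr rfl fun j _ => ?_
    ring
  simp only [h]
  exact tendsto_finsetSum _ fun i _ => tendsto_finsetSum _ fun j _ =>
    (tendsto_log_add_mul_sub_log (ha i) (hb j)).const_mul _

variable {A₁ B₁ U₁ V₁ A₂ B₂ U₂ V₂ : Matrix n n ℂ} {a₁ b₁ a₂ b₂ : n → ℝ}

/-- Joint convexity of the quantum relative entropy. -/
theorem spectralRelEntropy_combo_le {l m : ℝ} (hl : 0 ≤ l) (hm : 0 ≤ m)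
    (hA₁ : IsSpectralDecomp A₁ U₁ a₁) (hB₁ : IsSpectralDecomp B₁ V₁ b₁)
    (hA₂ : IsSpectralDecomp A₂ U₂ a₂) (hB₂ : IsSpectralDecomp B₂ V₂ b₂)
    (hA : IsSpectralDecomp ((l : ℂ) • A₁ + (m : ℂ) • A₂) U a)
    (hB : IsSpectralDecomp ((l : ℂ) • B₁ + (m : ℂ) • B₂) V b)
    (ha₁ : ∀ i, 0 ≤ a₁ i) (hb₁ : ∀ j, 0 < b₁ j) (ha₂ : ∀ i, 0 ≤ a₂ i) (hb₂ : ∀ j, 0 < b₂ j)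
    (ha : ∀ i, 0 ≤ a i) (hb : ∀ j, 0 < b j) :
    spectralRelEntropy U V a b
      ≤ l * spectralRelEntropy U₁ V₁ a₁ b₁ + m * spectralRelEntropy U₂ V₂ a₂ b₂ := by
  have hform : ∀ t : ℝ, 0 ≤ t → resolventForm t U V a b
      ≤ l * resolventForm t U₁ V₁ a₁ b₁ + m * resolventForm t U₂ V₂ a₂ b₂ := by
    intro t ht
    obtain ⟨X, hX⟩ := exists_resolventFunctional_eq hA hB ha hb ht
    rw [← hX, resolventFunctional_combo]
    gcongr
    · exact resolventFunctional_le hA₁ hB₁ ha₁ hb₁ ht X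
    · exact resolventFunctional_le hA₂ hB₂ ha₂ hb₂ ht X
  have hderiv : ∀ t : ℝ, 0 ≤ t → HasDerivAt
      (fun T => l * integratedForm T U₁ V₁ a₁ b₁ + m * integratedForm T U₂ V₂ a₂ b₂
        - integratedForm T U V a b)
      (l * resolventForm t U₁ V₁ a₁ b₁ + m * resolventForm t U₂ V₂ a₂ b₂
        - resolventForm t U V a b) t := fun t ht =>
    (((hasDerivAt_integratedForm ha₁ hb₁ ht).const_mul l).add
      ((hasDerivAt_integratedForm ha₂ hb₂ ht).const_mul m)).sub
      (hasDerivAt_integratedForm ha hb ht)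
  have hmono : MonotoneOn
      (fun T => l * integratedForm T U₁ V₁ a₁ b₁ + m * integratedForm T U₂ V₂ a₂ b₂
        - integratedForm T U V a b) (Set.Ici 0) := by
    refine monotoneOn_of_deriv_nonneg (convex_Ici 0)
      (fun t ht => (hderiv t ht).continuousAt.continuousWithinAt) ?_ ?_
    · intro t ht
      rw [interior_Ici] at ht
      exact (hderiv t (le_of_lt ht)).differentiableAt.differentiableWithinAt
    · intro t ht
      rw [interior_Ici] at ht
      rw [(hderiv t (le_of_lt ht)).deriv]
      linarith [hform t (le_of_lt ht)]
  have hint : ∀ T : ℝ, 0 ≤ T → integratedForm T U V a b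
      ≤ l * integratedForm T U₁ V₁ a₁ b₁ + m * integratedForm T U₂ V₂ a₂ b₂ := by
    intro T hT
    have := hmono (Set.mem_Ici.mpr le_rfl) (Set.mem_Ici.mpr hT) hT
    simp only [integratedForm, zero_mul, add_zero, sub_self, mul_zero,
      Finset.sum_const_zero] at this
    simp only [integratedForm]
    linarith
  refine le_of_tendsto_of_tendsto (tendsto_integratedForm hA hB ha hb)
    (((tendsto_integratedForm hA₁ hB₁ ha₁ hb₁).const_mul l).add
      ((tendsto_integratedForm hA₂ hB₂ ha₂ hb₂).const_mul m)) ?_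
  filter_upwards [eventually_ge_atTop 0] with T hT
  have htr : ((l : ℂ) • A₁ + (m : ℂ) • A₂).trace.re = l * A₁.trace.re + m * A₂.trace.re := by
    simp [trace_add, trace_smul]
  rw [htr]
  linarith [hint T hT]

theorem spectralRelEntropy_eq (hA : IsSpectralDecomp A U a) (hB : IsSpectralDecomp B V b)
    (c : n → ℝ) :
    spectralRelEntropy U V a c
      = ∑ i, a i * Real.log (a i) - ∑ j, ((Vᴴ * A * V) j j).re * Real.log (c j) := by
  have h1 : ∑ i, a i * Real.log (a i)
      = ∑ i, ∑ j, overlap U V i j * (a i * Real.log (a i)) := by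
    simp only [← Finset.sum_mul, sum_overlap_right hA.star_mul_self hB.mul_star_self, one_mul]
  have h2 : ∑ j, ((Vᴴ * A * V) j j).re * Real.log (c j)
      = ∑ i, ∑ j, overlap U V i j * a i * Real.log (c j) := by
    rw [Finset.sum_comm]
    simp only [← sum_overlap_left hA, Finset.sum_mul]
  rw [h1, h2, spectralRelEntropy]
  simp only [← Finset.sum_sub_distrib]
  refine Finset.sum_congr rfl fun i _ => Finset.sum_congr rfl fun j _ => ?_
  ring

end

section

variable {d : ℕ}

theorem ptraceB_combo (l m : ℂ) (ρ₁ ρ₂ : Matrix (Fin d × Fin d) (Fin d × Fin d) ℂ) :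
    ptraceB (l • ρ₁ + m • ρ₂) = l • ptraceB ρ₁ + m • ptraceB ρ₂ := by
  ext i j
  simp [ptraceB, Finset.sum_add_distrib, Finset.mul_sum]

theorem posSemidef_ptraceB {ρ : Matrix (Fin d × Fin d) (Fin d × Fin d) ℂ} (h : ρ.PosSemidef) :
    (ptraceB ρ).PosSemidef := by
  have : ptraceB ρ = ∑ i, ρ.submatrix (fun k => (i, k)) (fun k => (i, k)) := by
    ext k l
    simp [ptraceB, Matrix.sum_apply]
  rw [this]
  exact posSemidef_sum _ fun i _ => h.submatrix _

theorem IsSpectralDecomp.one_kronecker {M W : Matrix (Fin d) (Fin d) ℂ} {b : Fin d → ℝ}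
    (h : IsSpectralDecomp M W b) :
    IsSpectralDecomp ((1 : Matrix (Fin d) (Fin d) ℂ) ⊗ₖ M)
      ((1 : Matrix (Fin d) (Fin d) ℂ) ⊗ₖ W) (fun p => b p.2) where
  star_mul_self := by
    rw [conjTranspose_kronecker, ← mul_kronecker_mul, h.star_mul_self]
    simp
  eq := by
    have : diagonal (fun p : Fin d × Fin d => (b p.2 : ℂ))
        = (1 : Matrix (Fin d) (Fin d) ℂ) ⊗ₖ diagonal (fun i => (b i : ℂ)) := by
      rw [← diagonal_one, diagonal_kronecker_diagonal]
      simp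
    rw [this, conjTranspose_kronecker, ← mul_kronecker_mul, ← mul_kronecker_mul, ← h.eq]
    simp

theorem sum_conj_one_kronecker_apply (ρ : Matrix (Fin d × Fin d) (Fin d × Fin d) ℂ)
    (W : Matrix (Fin d) (Fin d) ℂ) (j : Fin d) :
    ∑ k, (((1 : Matrix (Fin d) (Fin d) ℂ) ⊗ₖ W)ᴴ * ρ *
      ((1 : Matrix (Fin d) (Fin d) ℂ) ⊗ₖ W)) (k, j) (k, j) = (Wᴴ * ptraceB ρ * W) j j := by
  simp only [Matrix.mul_apply, conjTranspose_apply, kroneckerMap_apply, Fintype.sum_prod_type,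
    Matrix.one_apply, ptraceB, of_apply]
  have hsum : ∀ x y : Fin d, ∑ z, ∑ i, (starRingEnd ℂ) (if z = x then W i j else 0)
      * ρ (z, i) (x, y) * W y j = ∑ i, (starRingEnd ℂ) (W i j) * ρ (x, i) (x, y) * W y j := by
    intro x y
    rw [Finset.sum_eq_single x (by intro z _ hz; simp [hz]) (by simp)]
    simp
  simp only [ite_mul, one_mul, zero_mul, mul_ite, mul_zero, Finset.sum_ite_irrel,
    Finset.sum_const_zero, Finset.sum_ite_eq', Finset.mem_univ, if_true, Finset.sum_mul,
    Finset.mul_sum, Complex.star_def, hsum]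
  rw [Finset.sum_comm]
  exact Finset.sum_congr rfl fun y _ => Finset.sum_comm

/-- Natural-logarithm version of `-condEntropy`, with the reduced state regularized inside the
logarithm. -/
def regularizedNegCondEntropy {ρ : Matrix (Fin d × Fin d) (Fin d × Fin d) ℂ}
    (h : ρ.PosSemidef) (ε : ℝ) : ℝ :=
  ∑ i, h.1.eigenvalues i * Real.log (h.1.eigenvalues i)
    - ∑ j, (posSemidef_ptraceB h).1.eigenvalues j *
        Real.log ((posSemidef_ptraceB h).1.eigenvalues j + ε)

theorem spectralRelEntropy_one_kronecker {ρ : Matrix (Fin d × Fin d) (Fin d × Fin d) ℂ}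
    (h : ρ.PosSemidef) (ε : ℝ) :
    spectralRelEntropy (h.1.eigenvectorUnitary : Matrix _ _ ℂ)
      ((1 : Matrix (Fin d) (Fin d) ℂ) ⊗ₖ
        ((posSemidef_ptraceB h).1.eigenvectorUnitary : Matrix (Fin d) (Fin d) ℂ))
      h.1.eigenvalues (fun p => (posSemidef_ptraceB h).1.eigenvalues p.2 + ε)
      = regularizedNegCondEntropy h ε := by
  have hM := IsSpectralDecomp.of_isHermitian (posSemidef_ptraceB h).1
  rw [spectralRelEntropy_eq (IsSpectralDecomp.of_isHermitian h.1) hM.one_kronecker,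
    regularizedNegCondEntropy]
  congr 1
  rw [Fintype.sum_prod_type_right]
  refine Finset.sum_congr rfl fun j _ => ?_
  dsimp only
  rw [← Finset.sum_mul, ← Complex.re_sum, sum_conj_one_kronecker_apply, hM.star_mul_mul]
  simp

theorem tendsto_regularizedNegCondEntropy {ρ : Matrix (Fin d × Fin d) (Fin d × Fin d) ℂ}
    (h : ρ.PosSemidef) :
    Tendsto (regularizedNegCondEntropy h) (𝓝[>] 0) (𝓝 (-(condEntropy ρ * Real.log 2))) := by
  have hlog2 : Real.log 2 ≠ 0 := (Real.log_pos one_lt_two).ne'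
  have hval : -(condEntropy ρ * Real.log 2)
      = ∑ i, h.1.eigenvalues i * Real.log (h.1.eigenvalues i)
        - ∑ j, (posSemidef_ptraceB h).1.eigenvalues j *
            Real.log ((posSemidef_ptraceB h).1.eigenvalues j) := by
    rw [condEntropy, vnEntropy, vnEntropy, dif_pos h.1, dif_pos (posSemidef_ptraceB h).1]
    simp only [Real.logb, ← mul_div_assoc, ← Finset.sum_div]
    field_simp
    ring
  rw [hval]
  refine Tendsto.const_sub _ (tendsto_finsetSum _ fun j _ => ?_)
  rcases eq_or_ne ((posSemidef_ptraceB h).1.eigenvalues j) 0 with h0 | h0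
  · simp [h0]
  · have : Tendsto (fun ε : ℝ => (posSemidef_ptraceB h).1.eigenvalues j + ε) (𝓝[>] 0)
        (𝓝 ((posSemidef_ptraceB h).1.eigenvalues j)) := by
      have := (tendsto_id (α := ℝ) (x := 𝓝 0)).const_add
        ((posSemidef_ptraceB h).1.eigenvalues j)
      rw [add_zero] at this
      exact this.mono_left nhdsWithin_le_nhds
    exact (this.log h0).const_mul _

/-- Concavity of the conditional von Neumann entropy. -/
theorem condEntropy_combo_ge {ρ₁ ρ₂ : Matrix (Fin d × Fin d) (Fin d × Fin d) ℂ}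
    (h₁ : ρ₁.PosSemidef) (h₂ : ρ₂.PosSemidef) {l m : ℝ} (hl : 0 ≤ l) (hm : 0 ≤ m)
    (hlm : l + m = 1) :
    l * condEntropy ρ₁ + m * condEntropy ρ₂
      ≤ condEntropy ((l : ℂ) • ρ₁ + (m : ℂ) • ρ₂) := by
  have h : ((l : ℂ) • ρ₁ + (m : ℂ) • ρ₂).PosSemidef :=
    (h₁.smul (by exact_mod_cast hl)).add (h₂.smul (by exact_mod_cast hm))
  have hreg : ∀ ε : ℝ, 0 < ε → regularizedNegCondEntropy h ε
      ≤ l * regularizedNegCondEntropy h₁ ε + m * regularizedNegCondEntropy h₂ ε := by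
    intro ε hε
    have key {ρ : Matrix (Fin d × Fin d) (Fin d × Fin d) ℂ} (hρ : ρ.PosSemidef) :=
      (IsSpectralDecomp.of_isHermitian (posSemidef_ptraceB hρ).1).one_kronecker.add_smul_one ε
    have hpos {ρ : Matrix (Fin d × Fin d) (Fin d × Fin d) ℂ} (hρ : ρ.PosSemidef)
        (p : Fin d × Fin d) : 0 < (posSemidef_ptraceB hρ).1.eigenvalues p.2 + ε :=
      add_pos_of_nonneg_of_pos ((posSemidef_ptraceB hρ).eigenvalues_nonneg _) hε
    have hB : (1 : Matrix (Fin d) (Fin d) ℂ) ⊗ₖ ptraceB ((l : ℂ) • ρ₁ + (m : ℂ) • ρ₂)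
          + (ε : ℂ) • 1
        = (l : ℂ) • ((1 : Matrix (Fin d) (Fin d) ℂ) ⊗ₖ ptraceB ρ₁ + (ε : ℂ) • 1)
          + (m : ℂ) • ((1 : Matrix (Fin d) (Fin d) ℂ) ⊗ₖ ptraceB ρ₂ + (ε : ℂ) • 1) := by
      have hlm' : (l : ℂ) + m = 1 := by exact_mod_cast hlm
      rw [ptraceB_combo, kronecker_add, kronecker_smul, kronecker_smul, smul_add, smul_add,
        add_add_add_comm, ← add_smul, hlm', one_smul]
    rw [← spectralRelEntropy_one_kronecker, ← spectralRelEntropy_one_kronecker,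
      ← spectralRelEntropy_one_kronecker]
    exact spectralRelEntropy_combo_le hl hm (.of_isHermitian h₁.1) (key h₁)
      (.of_isHermitian h₂.1) (key h₂) (.of_isHermitian h.1) (hB ▸ key h)
      h₁.eigenvalues_nonneg (hpos h₁) h₂.eigenvalues_nonneg (hpos h₂)
      h.eigenvalues_nonneg (hpos h)
  have hle := le_of_tendsto_of_tendsto (tendsto_regularizedNegCondEntropy h)
    (((tendsto_regularizedNegCondEntropy h₁).const_mul l).add
      ((tendsto_regularizedNegCondEntropy h₂).const_mul m))
    (by filter_upwards [self_mem_nhdsWithin] with ε hε using hreg ε hε)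
  have hlog2 : 0 < Real.log 2 := Real.log_pos one_lt_two
  refine le_of_mul_le_mul_right ?_ hlog2
  linarith

end

/-- CVENN is convex. -/
theorem cvenn_convex {d : ℕ} (hd : 0 < d)
    (σ₁ σ₂ : Matrix (Fin d × Fin d) (Fin d × Fin d) ℂ)
    (h₁ : IsState σ₁) (h₂ : IsState σ₂)
    (hc₁ : 0 ≤ condEntropy σ₁) (hc₂ : 0 ≤ condEntropy σ₂)
    (l : ℝ) (hl : l ∈ Set.Icc (0 : ℝ) 1) :
    0 ≤ condEntropy ((l : ℂ) • σ₁ + ((1 - l : ℝ) : ℂ) • σ₂) := by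
  have hl' : 0 ≤ 1 - l := sub_nonneg.mpr hl.2
  exact (add_nonneg (mul_nonneg hl.1 hc₁) (mul_nonneg hl' hc₂)).trans
    (condEntropy_combo_ge h₁.1 h₂.1 hl.1 hl' (by ring))
end
end

section
/- The conditional von Neumann entropy is concave: for states σ₁, σ₂ on ℂ^d ⊗ ℂ^d and λ ∈ [0,1], S_{A|B}(λ·σ₁ + (1−λ)·σ₂) ≥ λ·S_{A|B}(σ₁) + (1−λ)·S_{A|B}(σ₂). -/
open scoped Kronecker ComplexOrder
open Matrix

noncomputable section

/-- A pair of positive semidefinite matrices `U diag(p) Uᴴ` and `V diag(q) Vᴴ`, given by their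
spectral decompositions, such that the support of the first is contained in that of the second. -/
structure SpectralPair (n : Type*) [Fintype n] [DecidableEq n] where
  /-- eigenvectors of the first matrix -/
  U : Matrix n n ℂ
  /-- eigenvectors of the second matrix -/
  V : Matrix n n ℂ
  /-- eigenvalues of the first matrix -/
  p : n → ℝ
  /-- eigenvalues of the second matrix -/
  q : n → ℝ
  U_star_mul : Uᴴ * U = 1
  V_star_mul : Vᴴ * V = 1
  p_nonneg : ∀ i, 0 ≤ p i
  q_nonneg : ∀ j, 0 ≤ q j
  support : ∀ j i, q j = 0 → Complex.normSq ((Vᴴ * U) j i) * p i = 0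

/-- The variational functional whose supremum over `Y` is `⟨ρ, (L_σ + t R_ρ)⁻¹ ρ⟩`. -/
def variationalForm {n : Type*} [Fintype n] (t : ℝ) (Y ρ σ : Matrix n n ℂ) : ℝ :=
  (2 * (Yᴴ * ρ).trace - (Yᴴ * σ * Y).trace - t * (Yᴴ * Y * ρ).trace).re

lemma variationalForm_mix {n : Type*} [Fintype n] (t l : ℝ) (Y ρ₁ σ₁ ρ₂ σ₂ : Matrix n n ℂ) :
    variationalForm t Y ((l : ℂ) • ρ₁ + ((1 - l : ℝ) : ℂ) • ρ₂)
        ((l : ℂ) • σ₁ + ((1 - l : ℝ) : ℂ) • σ₂) =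
      l * variationalForm t Y ρ₁ σ₁ + (1 - l) * variationalForm t Y ρ₂ σ₂ := by
  simp only [variationalForm, Matrix.mul_add, Matrix.add_mul, Matrix.mul_smul, Matrix.smul_mul,
    Matrix.trace_add, Matrix.trace_smul, smul_eq_mul, Complex.sub_re, Complex.add_re,
    Complex.mul_re, Complex.add_im, Complex.mul_im, Complex.ofReal_re, Complex.ofReal_im,
    Complex.re_ofNat, Complex.im_ofNat]
  ring

lemma two_re_sub_le (z m : ℂ) {p q t : ℝ} (hp : 0 ≤ p) (hq : 0 ≤ q) (ht : 0 < t) :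
    2 * (star z * m).re * p - (q + t * p) * Complex.normSq z ≤
      Complex.normSq m * p ^ 2 / (q + t * p) := by
  rcases (show 0 ≤ q + t * p by positivity).eq_or_lt with h | h
  · have : p = 0 := by
      have : 0 ≤ t * p := by positivity
      have : t * p = 0 := by linarith
      simpa [ht.ne'] using this
    rw [← h, this]
    simp
  · rw [le_div_iff₀ h]
    simp only [Complex.normSq_apply, Complex.mul_re, Complex.star_def, Complex.conj_re,
      Complex.conj_im]
    nlinarith [sq_nonneg ((q + t * p) * z.re - m.re * p), sq_nonneg ((q + t * p) * z.im - m.im * p)]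

lemma two_re_sub_eq (m : ℂ) {p q t : ℝ} (hp : 0 ≤ p) (hq : 0 ≤ q) (ht : 0 < t) :
    2 * (star (m * ((p / (q + t * p) : ℝ) : ℂ)) * m).re * p
        - (q + t * p) * Complex.normSq (m * ((p / (q + t * p) : ℝ) : ℂ)) =
      Complex.normSq m * p ^ 2 / (q + t * p) := by
  rcases (show 0 ≤ q + t * p by positivity).eq_or_lt with h | h
  · simp [← h]
  · simp only [Complex.normSq_apply, Complex.mul_re, Complex.mul_im, Complex.star_def,
      Complex.conj_re, Complex.conj_im, Complex.ofReal_re, Complex.ofReal_im]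
    have := h.ne'
    generalize q + t * p = a at this
    field_simp
    ring

namespace SpectralPair

variable {n : Type*} [Fintype n] [DecidableEq n] (D : SpectralPair n)

/-- the first matrix of the pair -/
def fst : Matrix n n ℂ := D.U * diagonal (fun i => (D.p i : ℂ)) * D.Uᴴ

/-- the second matrix of the pair -/
def snd : Matrix n n ℂ := D.V * diagonal (fun i => (D.q i : ℂ)) * D.Vᴴ

/-- the squared overlaps of the two eigenbases -/
def overlap (j i : n) : ℝ := Complex.normSq ((D.Vᴴ * D.U) j i)

/-- An antiderivative of `t ↦ ⟨ρ, (L_σ + t R_ρ)⁻¹ ρ⟩`. -/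
def potential (t : ℝ) : ℝ := ∑ j, ∑ i, D.overlap j i * (D.p i * Real.log (D.q j + t * D.p i))

/-- The quantity `⟨ρ, (L_σ + t R_ρ)⁻¹ ρ⟩`. -/
def resolvent (t : ℝ) : ℝ := ∑ j, ∑ i, D.overlap j i * D.p i ^ 2 / (D.q j + t * D.p i)

lemma U_mul_star : D.U * D.Uᴴ = 1 := mul_eq_one_comm.mp D.U_star_mul

lemma V_mul_star : D.V * D.Vᴴ = 1 := mul_eq_one_comm.mp D.V_star_mul

lemma trace_star_mul_diagonal_mul (Z : Matrix n n ℂ) (q : n → ℝ) :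
    (Zᴴ * diagonal (fun i => (q i : ℂ)) * Z).trace.re =
      ∑ j, ∑ i, q j * Complex.normSq (Z j i) := by
  rw [Finset.sum_comm]
  simp only [Matrix.trace, Matrix.diag, Matrix.mul_apply (M := Zᴴ * _), Matrix.mul_diagonal,
    Matrix.conjTranspose_apply, Complex.re_sum]
  refine Finset.sum_congr rfl fun i _ => Finset.sum_congr rfl fun j _ => ?_
  simp [Complex.normSq_apply]
  ring

lemma trace_star_mul_mul_diagonal (Z W : Matrix n n ℂ) (p : n → ℝ) :
    (Zᴴ * W * diagonal (fun i => (p i : ℂ))).trace.re =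
      ∑ j, ∑ i, (star (Z j i) * W j i).re * p i := by
  rw [Finset.sum_comm]
  simp only [Matrix.trace, Matrix.diag, Matrix.mul_diagonal, Matrix.mul_apply (M := Zᴴ),
    Matrix.conjTranspose_apply, Complex.re_sum, Complex.re_mul_ofReal, Finset.sum_mul]

lemma variationalForm_eq (t : ℝ) (Z : Matrix n n ℂ) :
    variationalForm t (D.V * Z * D.Uᴴ) D.fst D.snd =
      ∑ j, ∑ i, (2 * (star (Z j i) * (D.Vᴴ * D.U) j i).re * D.p i
        - (D.q j + t * D.p i) * Complex.normSq (Z j i)) := by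
  have hU : ∀ X : Matrix n n ℂ, D.Uᴴ * (D.U * X) = X := fun X => by
    rw [← Matrix.mul_assoc, D.U_star_mul, Matrix.one_mul]
  have hV : ∀ X : Matrix n n ℂ, D.Vᴴ * (D.V * X) = X := fun X => by
    rw [← Matrix.mul_assoc, D.V_star_mul, Matrix.one_mul]
  have tr : ∀ X : Matrix n n ℂ, (D.U * X * D.Uᴴ).trace = X.trace := fun X => by
    rw [Matrix.trace_mul_comm, hU]
  have e1 : ((D.V * Z * D.Uᴴ)ᴴ * D.fst).trace =
      (Zᴴ * (D.Vᴴ * D.U) * diagonal (fun i => (D.p i : ℂ))).trace := by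
    rw [← tr (Zᴴ * _ * diagonal _)]
    simp only [fst, Matrix.conjTranspose_mul, Matrix.conjTranspose_conjTranspose, Matrix.mul_assoc]
  have e2 : ((D.V * Z * D.Uᴴ)ᴴ * D.snd * (D.V * Z * D.Uᴴ)).trace =
      (Zᴴ * diagonal (fun i => (D.q i : ℂ)) * Z).trace := by
    rw [← tr (_ * Z)]
    simp only [snd, Matrix.conjTranspose_mul, Matrix.conjTranspose_conjTranspose,
      Matrix.mul_assoc, hV]
  have e3 : ((D.V * Z * D.Uᴴ)ᴴ * (D.V * Z * D.Uᴴ) * D.fst).trace =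
      (Zᴴ * Z * diagonal (fun i => (D.p i : ℂ))).trace := by
    rw [← tr (_ * diagonal _)]
    simp only [fst, Matrix.conjTranspose_mul, Matrix.conjTranspose_conjTranspose,
      Matrix.mul_assoc, hU, hV]
  rw [variationalForm, e1, e2, e3, Complex.sub_re, Complex.sub_re, Complex.re_ofReal_mul,
    trace_star_mul_diagonal_mul, trace_star_mul_mul_diagonal,
    show (2 : ℂ) = ((2 : ℝ) : ℂ) by norm_num, Complex.re_ofReal_mul, trace_star_mul_mul_diagonal]
  simp only [Finset.mul_sum, ← Finset.sum_sub_distrib]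
  refine Finset.sum_congr rfl fun j _ => Finset.sum_congr rfl fun i _ => ?_
  simp only [Complex.normSq_apply, Complex.mul_re, Complex.star_def, Complex.conj_re,
      Complex.conj_im]
  ring

lemma variationalForm_le {t : ℝ} (ht : 0 < t) (Y : Matrix n n ℂ) :
    variationalForm t Y D.fst D.snd ≤ D.resolvent t := by
  have hY : Y = D.V * (D.Vᴴ * Y * D.U) * D.Uᴴ := by
    simp only [← Matrix.mul_assoc, D.V_mul_star, Matrix.one_mul]
    rw [Matrix.mul_assoc, D.U_mul_star, Matrix.mul_one]
  rw [hY, variationalForm_eq]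
  exact Finset.sum_le_sum fun j _ => Finset.sum_le_sum fun i _ =>
    two_re_sub_le _ _ (D.p_nonneg i) (D.q_nonneg j) ht

lemma exists_variationalForm_eq {t : ℝ} (ht : 0 < t) :
    ∃ Y, variationalForm t Y D.fst D.snd = D.resolvent t := by
  refine ⟨D.V * Matrix.of (fun j i => (D.Vᴴ * D.U) j i *
    ((D.p i / (D.q j + t * D.p i) : ℝ) : ℂ)) * D.Uᴴ, ?_⟩
  rw [variationalForm_eq]
  exact Finset.sum_congr rfl fun j _ => Finset.sum_congr rfl fun i _ =>
    two_re_sub_eq _ (D.p_nonneg i) (D.q_nonneg j) ht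

lemma sum_overlap (i : n) : ∑ j, D.overlap j i = 1 := by
  have h : ((D.Vᴴ * D.U)ᴴ * (D.Vᴴ * D.U)) i i = 1 := by
    rw [Matrix.conjTranspose_mul, Matrix.conjTranspose_conjTranspose, Matrix.mul_assoc,
      ← Matrix.mul_assoc D.V, D.V_mul_star, Matrix.one_mul, D.U_star_mul, Matrix.one_apply_eq]
  rw [Matrix.mul_apply] at h
  have h' := congrArg Complex.re h
  rw [Complex.re_sum, Complex.one_re] at h'
  rw [← h']
  refine Finset.sum_congr rfl fun j _ => ?_
  simp [overlap, Complex.normSq_apply, Matrix.conjTranspose_apply]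

lemma sum_overlap_mul (f : n → ℝ) : ∑ j, ∑ i, D.overlap j i * f i = ∑ i, f i := by
  rw [Finset.sum_comm]
  simp [← Finset.sum_mul, D.sum_overlap]

lemma hasDerivAt_potential {t : ℝ} (ht : 0 < t) :
    HasDerivAt D.potential (D.resolvent t) t := by
  unfold potential resolvent
  refine HasDerivAt.fun_sum fun j _ => HasDerivAt.fun_sum fun i _ => ?_
  rcases (D.p_nonneg i).eq_or_lt with h | h
  · simp [← h, hasDerivAt_const]
  · have hq := D.q_nonneg j
    have hpos : 0 < D.q j + t * D.p i := by positivity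
    have := ((((hasDerivAt_id t).mul_const (D.p i)).const_add (D.q j)).log hpos.ne').const_mul
      (D.p i) |>.const_mul (D.overlap j i)
    refine this.congr_deriv ?_
    simp only [one_mul, id]
    ring

lemma continuousOn_potential : ContinuousOn D.potential (Set.Ici 0) := by
  unfold potential
  refine continuousOn_finsetSum _ fun j _ => continuousOn_finsetSum _ fun i _ => ?_
  rcases (D.q_nonneg j).eq_or_lt with h | h
  · have := D.support j i h.symm
    simp only [← mul_assoc, overlap, this, zero_mul]
    exact continuousOn_const
  · refine continuousOn_const.mul (continuousOn_const.mul (ContinuousOn.log (by fun_prop) ?_))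
    intro t ht
    have : 0 ≤ t * D.p i := mul_nonneg ht (D.p_nonneg i)
    positivity

lemma tendsto_potential_sub :
    Filter.Tendsto (fun t => D.potential t - Real.log t * ∑ i, D.p i) Filter.atTop
      (nhds (∑ i, D.p i * Real.log (D.p i))) := by
  have key : Filter.Tendsto (fun t => ∑ j, ∑ i, D.overlap j i *
      (D.p i * Real.log (D.q j / t + D.p i))) Filter.atTop
      (nhds (∑ j, ∑ i, D.overlap j i * (D.p i * Real.log (D.p i)))) := by
    refine tendsto_finsetSum _ fun j _ => tendsto_finsetSum _ fun i _ => ?_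
    rcases eq_or_ne (D.p i) 0 with h | h
    · simp [h]
    · refine ((Filter.Tendsto.log ?_ h).const_mul _).const_mul _
      simpa using (Filter.Tendsto.const_div_atTop Filter.tendsto_id (D.q j)).add_const (D.p i)
  rw [D.sum_overlap_mul] at key
  refine key.congr' ?_
  filter_upwards [Filter.eventually_gt_atTop 0] with t ht
  rw [← D.sum_overlap_mul D.p, potential]
  simp only [Finset.mul_sum, ← Finset.sum_sub_distrib]
  refine Finset.sum_congr rfl fun j _ => Finset.sum_congr rfl fun i _ => ?_
  rcases (D.p_nonneg i).eq_or_lt with h | h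
  · simp [← h]
  · have hq := D.q_nonneg j
    rw [show D.q j / t + D.p i = (D.q j + t * D.p i) / t by field_simp,
      Real.log_div (by positivity) ht.ne']
    ring

lemma trace_fst : D.fst.trace = ((∑ i, D.p i : ℝ) : ℂ) := by
  rw [fst, Matrix.trace_mul_comm, ← Matrix.mul_assoc, D.U_star_mul, Matrix.one_mul,
    Matrix.trace_diagonal, Complex.ofReal_sum]

/-- Joint convexity of the quantum relative entropy, in terms of spectral decompositions. -/
theorem relativeEntropy_convex (D₀ D₁ D₂ : SpectralPair n) {l : ℝ} (hl : l ∈ Set.Icc (0 : ℝ) 1)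
    (hfst : D₀.fst = (l : ℂ) • D₁.fst + ((1 - l : ℝ) : ℂ) • D₂.fst)
    (hsnd : D₀.snd = (l : ℂ) • D₁.snd + ((1 - l : ℝ) : ℂ) • D₂.snd) :
    (∑ i, D₀.p i * Real.log (D₀.p i)) - D₀.potential 0 ≤
      l * ((∑ i, D₁.p i * Real.log (D₁.p i)) - D₁.potential 0) +
      (1 - l) * ((∑ i, D₂.p i * Real.log (D₂.p i)) - D₂.potential 0) := by
  have hp : ∑ i, D₀.p i = l * ∑ i, D₁.p i + (1 - l) * ∑ i, D₂.p i := by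
    have := congrArg Matrix.trace hfst
    rw [Matrix.trace_add, Matrix.trace_smul, Matrix.trace_smul, trace_fst, trace_fst,
      trace_fst, smul_eq_mul, smul_eq_mul] at this
    exact_mod_cast this
  set G : ℝ → ℝ := fun t => l * D₁.potential t + (1 - l) * D₂.potential t - D₀.potential t
    with hG
  have hres : ∀ t, 0 < t →
      0 ≤ l * D₁.resolvent t + (1 - l) * D₂.resolvent t - D₀.resolvent t := by
    intro t ht
    obtain ⟨Y, hY⟩ := D₀.exists_variationalForm_eq ht
    rw [← hY, hfst, hsnd, variationalForm_mix]
    have h1 := mul_le_mul_of_nonneg_left (D₁.variationalForm_le ht Y) hl.1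
    have h2 := mul_le_mul_of_nonneg_left (D₂.variationalForm_le ht Y) (sub_nonneg.mpr hl.2)
    linarith
  have hderiv : ∀ t, 0 < t → HasDerivAt G
      (l * D₁.resolvent t + (1 - l) * D₂.resolvent t - D₀.resolvent t) t := fun t ht =>
    (((D₁.hasDerivAt_potential ht).const_mul l).add
      ((D₂.hasDerivAt_potential ht).const_mul (1 - l))).sub (D₀.hasDerivAt_potential ht)
  have hmono : MonotoneOn G (Set.Ici 0) := by
    refine monotoneOn_of_deriv_nonneg (convex_Ici 0) ?_ ?_ ?_
    · exact ((continuousOn_const.mul D₁.continuousOn_potential).add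
        (continuousOn_const.mul D₂.continuousOn_potential)).sub D₀.continuousOn_potential
    · rw [interior_Ici]
      exact fun t ht => (hderiv t ht).differentiableAt.differentiableWithinAt
    · rw [interior_Ici]
      exact fun t ht => (hderiv t ht).deriv ▸ hres t ht
  have hlim : Filter.Tendsto G Filter.atTop (nhds (l * (∑ i, D₁.p i * Real.log (D₁.p i)) +
      (1 - l) * (∑ i, D₂.p i * Real.log (D₂.p i)) - ∑ i, D₀.p i * Real.log (D₀.p i))) := by
    refine (((D₁.tendsto_potential_sub.const_mul l).add
      (D₂.tendsto_potential_sub.const_mul (1 - l))).sub D₀.tendsto_potential_sub).congr fun t => ?_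
    rw [hp, hG]
    ring
  have hle : G 0 ≤ _ := ge_of_tendsto hlim (by
    filter_upwards [Filter.eventually_ge_atTop 0] with t ht
    exact hmono Set.self_mem_Ici ht ht)
  simp only [hG] at hle
  linarith

end SpectralPair

lemma ptraceB_mix {d : ℕ} (a b : ℂ) (ρ σ : Matrix (Fin d × Fin d) (Fin d × Fin d) ℂ) :
    ptraceB (a • ρ + b • σ) = a • ptraceB ρ + b • ptraceB σ := by
  ext k l
  simp [ptraceB, Finset.sum_add_distrib, Finset.mul_sum]

lemma ptraceB_conj_one_kronecker {d : ℕ} (ρ : Matrix (Fin d × Fin d) (Fin d × Fin d) ℂ)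
    (A B : Matrix (Fin d) (Fin d) ℂ) :
    ptraceB (((1 : Matrix (Fin d) (Fin d) ℂ) ⊗ₖ A) * ρ * ((1 : Matrix (Fin d) (Fin d) ℂ) ⊗ₖ B)) =
      A * ptraceB ρ * B := by
  ext k l
  simp only [ptraceB, Matrix.of_apply, Matrix.mul_apply, Fintype.sum_prod_type,
    Matrix.kroneckerMap_apply, Matrix.one_apply, ite_mul, one_mul, zero_mul, mul_ite, mul_zero,
    Finset.sum_ite_irrel, Finset.sum_const_zero, Finset.sum_ite_eq, Finset.sum_ite_eq',
    Finset.mem_univ, if_true, Finset.sum_mul, Finset.mul_sum]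
  rw [Finset.sum_comm]
  exact Finset.sum_congr rfl fun _ _ => Finset.sum_comm

lemma ptraceB_posSemidef {d : ℕ} {ρ : Matrix (Fin d × Fin d) (Fin d × Fin d) ℂ}
    (h : ρ.PosSemidef) : (ptraceB ρ).PosSemidef := by
  have : ptraceB ρ = ∑ i, ρ.submatrix (fun k => (i, k)) (fun k => (i, k)) := by
    ext k l
    simp [ptraceB, Matrix.sum_apply]
  rw [this]
  exact Matrix.posSemidef_sum _ fun i _ => h.submatrix _

lemma exists_spectralPair {d : ℕ} {ρ : Matrix (Fin d × Fin d) (Fin d × Fin d) ℂ}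
    (h : ρ.PosSemidef) : ∃ D : SpectralPair (Fin d × Fin d), D.fst = ρ ∧
      D.snd = (1 : Matrix (Fin d) (Fin d) ℂ) ⊗ₖ ptraceB ρ ∧
      (∑ i, D.p i * Real.log (D.p i)) - D.potential 0 = -(Real.log 2 * condEntropy ρ) := by
  have hB := ptraceB_posSemidef h
  set U : Matrix (Fin d × Fin d) (Fin d × Fin d) ℂ := h.1.eigenvectorUnitary.1
  set W : Matrix (Fin d) (Fin d) ℂ := hB.1.eigenvectorUnitary.1
  set p := h.1.eigenvalues
  set q := hB.1.eigenvalues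
  have hUU : Uᴴ * U = 1 := Unitary.coe_star_mul_self h.1.eigenvectorUnitary
  have hWW : Wᴴ * W = 1 := Unitary.coe_star_mul_self hB.1.eigenvectorUnitary
  have hρ : ρ = U * diagonal (fun i => (p i : ℂ)) * Uᴴ := h.1.spectral_theorem
  have hρB : ptraceB ρ = W * diagonal (fun i => (q i : ℂ)) * Wᴴ := hB.1.spectral_theorem
  set V := (1 : Matrix (Fin d) (Fin d) ℂ) ⊗ₖ W with hV
  have hVH : Vᴴ = (1 : Matrix (Fin d) (Fin d) ℂ) ⊗ₖ Wᴴ := by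
    rw [hV, Matrix.conjTranspose_kronecker, Matrix.conjTranspose_one]
  have hVV : Vᴴ * V = 1 := by
    rw [hVH, hV, ← Matrix.mul_kronecker_mul, hWW, Matrix.one_mul, Matrix.one_kronecker_one]
  have hdiag : ∀ x, ∑ i, Complex.normSq ((Vᴴ * U) x i) * p i = ((Vᴴ * ρ * V) x x).re := by
    intro x
    have : Vᴴ * ρ * V = (Vᴴ * U) * diagonal (fun i => (p i : ℂ)) * (Vᴴ * U)ᴴ := by
      rw [hρ, Matrix.conjTranspose_mul, Matrix.conjTranspose_conjTranspose]
      simp only [Matrix.mul_assoc]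
    rw [this, Matrix.mul_apply, Complex.re_sum]
    refine Finset.sum_congr rfl fun i _ => ?_
    rw [Matrix.mul_diagonal, Matrix.conjTranspose_apply]
    simp [Complex.normSq_apply]
    ring
  have hmarg : ∀ j, ∑ k, ∑ i, Complex.normSq ((Vᴴ * U) (k, j) i) * p i = q j := by
    intro j
    simp only [hdiag]
    have : ptraceB (Vᴴ * ρ * V) = diagonal (fun i => (q i : ℂ)) := by
      rw [hVH, hV, ptraceB_conj_one_kronecker, hρB]
      simp only [Matrix.mul_assoc]
      rw [hWW, Matrix.mul_one, ← Matrix.mul_assoc, hWW, Matrix.one_mul]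
    have := congrArg Complex.re (congrFun (congrFun this j) j)
    rwa [Matrix.diagonal_apply_eq, Complex.ofReal_re, ptraceB, Matrix.of_apply,
      Complex.re_sum] at this
  have hterm : ∀ x i, 0 ≤ Complex.normSq ((Vᴴ * U) x i) * p i := fun x i =>
    mul_nonneg (Complex.normSq_nonneg _) (h.eigenvalues_nonneg i)
  have hsupp : ∀ x i, q x.2 = 0 → Complex.normSq ((Vᴴ * U) x i) * p i = 0 := by
    rintro ⟨k, j⟩ i hj
    have h0 := hmarg j
    rw [show q j = 0 from hj, Finset.sum_eq_zero_iff_of_nonneg fun k _ =>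
      Finset.sum_nonneg fun i _ => hterm (k, j) i] at h0
    have h1 := h0 k (Finset.mem_univ k)
    rw [Finset.sum_eq_zero_iff_of_nonneg fun i _ => hterm (k, j) i] at h1
    exact h1 i (Finset.mem_univ i)
  let D : SpectralPair (Fin d × Fin d) := ⟨U, V, p, fun x => q x.2, hUU, hVV,
    h.eigenvalues_nonneg, fun x => hB.eigenvalues_nonneg x.2, hsupp⟩
  refine ⟨D, hρ.symm, ?_, ?_⟩
  · have : diagonal (fun x : Fin d × Fin d => (q x.2 : ℂ)) =
        (1 : Matrix (Fin d) (Fin d) ℂ) ⊗ₖ diagonal (fun i => (q i : ℂ)) := by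
      rw [← Matrix.diagonal_one, Matrix.diagonal_kronecker_diagonal]
      simp
    simp only [D, SpectralPair.snd]
    rw [this, hVH, hV, ← Matrix.mul_kronecker_mul, ← Matrix.mul_kronecker_mul, hρB,
      Matrix.one_mul, Matrix.one_mul]
  · have hpot : D.potential 0 = ∑ j, q j * Real.log (q j) := by
      simp only [D, SpectralPair.potential, SpectralPair.overlap, zero_mul, add_zero, ← mul_assoc,
        ← Finset.sum_mul]
      rw [Fintype.sum_prod_type_right]
      simp only [← Finset.sum_mul, hmarg]
    rw [hpot, condEntropy, vnEntropy, vnEntropy, dif_pos h.1, dif_pos hB.1]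
    simp only [Real.logb, mul_div_assoc', ← Finset.sum_div]
    have : Real.log 2 ≠ 0 := (Real.log_pos one_lt_two).ne'
    field_simp
    ring

/-- conditional von Neumann entropy is concave. -/
theorem condEntropy_concave {d : ℕ} (hd : 0 < d)
    (σ₁ σ₂ : Matrix (Fin d × Fin d) (Fin d × Fin d) ℂ)
    (h₁ : IsState σ₁) (h₂ : IsState σ₂)
    (l : ℝ) (hl : l ∈ Set.Icc (0 : ℝ) 1) :
    l * condEntropy σ₁ + (1 - l) * condEntropy σ₂ ≤
      condEntropy ((l : ℂ) • σ₁ + ((1 - l : ℝ) : ℂ) • σ₂) := by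
  have h₀ : ((l : ℂ) • σ₁ + ((1 - l : ℝ) : ℂ) • σ₂).PosSemidef :=
    (h₁.1.smul (Complex.zero_le_real.mpr hl.1)).add
      (h₂.1.smul (Complex.zero_le_real.mpr (sub_nonneg.mpr hl.2)))
  obtain ⟨D₀, hf₀, hs₀, he₀⟩ := exists_spectralPair h₀
  obtain ⟨D₁, hf₁, hs₁, he₁⟩ := exists_spectralPair h₁.1
  obtain ⟨D₂, hf₂, hs₂, he₂⟩ := exists_spectralPair h₂.1
  have key := SpectralPair.relativeEntropy_convex D₀ D₁ D₂ hl (by rw [hf₀, hf₁, hf₂]) (by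
    rw [hs₀, hs₁, hs₂, ptraceB_mix, Matrix.kronecker_add, Matrix.kronecker_smul,
      Matrix.kronecker_smul])
  rw [he₀, he₁, he₂] at key
  refine le_of_mul_le_mul_left ?_ (Real.log_pos one_lt_two)
  linarith
end
end

section
/- For every state σ on ℂ^d ⊗ ℂ^d, the conditional von Neumann entropy is bounded above by log₂ d: S_{A|B}(σ) ≤ S(σ_A) ≤ log₂ d, where σ_A is the partial trace of σ over the second subsystem. -/
open scoped Kronecker ComplexOrder
open Matrix

noncomputable section

theorem Matrix.IsHermitian.star_eigenvectorUnitary_mul_mul {n : Type*} [Fintype n] [DecidableEq n]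
    {M : Matrix n n ℂ} (h : M.IsHermitian) :
    star (h.eigenvectorUnitary : Matrix n n ℂ) * M * (h.eigenvectorUnitary : Matrix n n ℂ) =
      diagonal (fun i => (h.eigenvalues i : ℂ)) := by
  have := h.conjStarAlgAut_star_eigenvectorUnitary
  simpa [Unitary.conjStarAlgAut_apply, Function.comp_def] using this

theorem sum_normSq_col {n : Type*} [Fintype n] [DecidableEq n]
    {X : Matrix n n ℂ} (h : star X * X = 1) (j : n) : ∑ i, Complex.normSq (X i j) = 1 := by
  have := congrFun (congrFun h j) j
  rw [Matrix.mul_apply, one_apply_eq] at this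
  simp only [star_apply, RCLike.star_def, ← Complex.normSq_eq_conj_mul_self] at this
  exact_mod_cast this

theorem sum_normSq_row {n : Type*} [Fintype n] [DecidableEq n]
    {X : Matrix n n ℂ} (h : X * star X = 1) (i : n) : ∑ j, Complex.normSq (X i j) = 1 := by
  have := congrFun (congrFun h i) i
  rw [Matrix.mul_apply, one_apply_eq] at this
  simp only [star_apply, RCLike.star_def, Complex.mul_conj] at this
  exact_mod_cast this

theorem star_mul_diagonal_mul_apply_self {n : Type*} [Fintype n] [DecidableEq n]
    (X : Matrix n n ℂ) (l : n → ℝ) (j : n) :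
    (star X * diagonal (fun i => (l i : ℂ)) * X) j j =
      ((∑ i, l i * Complex.normSq (X i j) : ℝ) : ℂ) := by
  rw [Matrix.mul_apply]
  push_cast
  refine Finset.sum_congr rfl fun i _ => ?_
  rw [mul_diagonal, Complex.normSq_eq_conj_mul_self, star_apply, RCLike.star_def]
  ring

theorem sum_conj_kronecker_snd {d : ℕ} (σ : Matrix (Fin d × Fin d) (Fin d × Fin d) ℂ)
    (U : Matrix (Fin d) (Fin d) ℂ) {V : Matrix (Fin d) (Fin d) ℂ} (hV : V * star V = 1)
    (a : Fin d) :
    ∑ b, (star (U ⊗ₖ V) * σ * (U ⊗ₖ V)) (a, b) (a, b) = (star U * ptraceA σ * U) a a := by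
  have key (k l : Fin d) : ∑ b, star (V k b) * V l b = if l = k then 1 else 0 := by
    have := congrFun (congrFun hV l) k
    simp only [Matrix.mul_apply, one_apply, star_apply] at this
    simpa [mul_comm] using this
  simp only [Matrix.mul_apply, Fintype.sum_prod_type, star_apply, kroneckerMap_apply, ptraceA, of_apply,
    Finset.sum_mul, Finset.mul_sum, star_mul']
  calc _ = ∑ j, ∑ l, ∑ i, ∑ k, star (U i a) * σ (i, k) (j, l) * U j a *
        ∑ b, star (V k b) * V l b := by
        simp only [Finset.mul_sum]
        rw [Finset.sum_comm]
        refine Finset.sum_congr rfl fun j _ => ?_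
        rw [Finset.sum_comm]
        refine Finset.sum_congr rfl fun l _ => ?_
        rw [Finset.sum_comm]
        refine Finset.sum_congr rfl fun i _ => ?_
        rw [Finset.sum_comm]
        refine Finset.sum_congr rfl fun k _ => Finset.sum_congr rfl fun b _ => ?_
        ring
    _ = _ := by
        simp only [key, mul_ite, mul_one, mul_zero, Finset.sum_ite_eq, Finset.mem_univ, if_true]
        refine Finset.sum_congr rfl fun j _ => ?_
        rw [Finset.sum_comm]

theorem sum_conj_kronecker_fst {d : ℕ} (σ : Matrix (Fin d × Fin d) (Fin d × Fin d) ℂ)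
    {U : Matrix (Fin d) (Fin d) ℂ} (V : Matrix (Fin d) (Fin d) ℂ) (hU : U * star U = 1)
    (b : Fin d) :
    ∑ a, (star (U ⊗ₖ V) * σ * (U ⊗ₖ V)) (a, b) (a, b) = (star V * ptraceB σ * V) b b := by
  have e : U ⊗ₖ V =
      (V ⊗ₖ U).submatrix (Equiv.prodComm (Fin d) (Fin d)) (Equiv.prodComm (Fin d) (Fin d)) := by
    ext i j
    simp [mul_comm]
  have hσ : σ = (σ.submatrix Prod.swap Prod.swap).submatrix
      (Equiv.prodComm (Fin d) (Fin d)) (Equiv.prodComm (Fin d) (Fin d)) := by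
    ext i j
    simp
  refine Eq.trans (Finset.sum_congr rfl fun a _ => ?_)
    (sum_conj_kronecker_snd (σ.submatrix Prod.swap Prod.swap) V hU b)
  conv_lhs => rw [e, hσ, star_eq_conjTranspose, conjTranspose_submatrix, submatrix_mul_equiv,
    submatrix_mul_equiv]
  rfl

theorem mul_sub_mul_le_mul_log {p l r s : ℝ} (hp : 0 ≤ p) (hl : 0 ≤ l) (hr : 0 ≤ r) (hs : 0 ≤ s)
    (hr' : r = 0 → l * p = 0) (hs' : s = 0 → l * p = 0) :
    p * l - p * (r * s) ≤ l * p * (Real.log l - Real.log r - Real.log s) := by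
  rcases eq_or_ne (l * p) 0 with h | h
  · rw [h, mul_comm p l, h]
    have : 0 ≤ p * (r * s) := by positivity
    linarith
  · have hl0 : 0 < l := hl.lt_of_ne' (left_ne_zero_of_mul h)
    have hr0 : 0 < r := hr.lt_of_ne' (mt hr' h)
    have hs0 : 0 < s := hs.lt_of_ne' (mt hs' h)
    have key := Real.log_le_sub_one_of_pos (show 0 < r * s / l by positivity)
    rw [Real.log_div (by positivity) hl0.ne', Real.log_mul hr0.ne' hs0.ne'] at key
    have h2 := mul_le_mul_of_nonneg_left key (show 0 ≤ l * p by positivity)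
    have h3 : l * p * (r * s / l - 1) = p * (r * s) - p * l := by
      field_simp
    rw [h3] at h2
    linarith

theorem vnEntropy_eq_log {n : Type*} [Fintype n] [DecidableEq n] {M : Matrix n n ℂ}
    (h : M.IsHermitian) :
    vnEntropy M = -(∑ i, h.eigenvalues i * Real.log (h.eigenvalues i)) / Real.log 2 := by
  simp only [vnEntropy, dif_pos h, Real.logb, neg_div, Finset.sum_div, mul_div_assoc]

/-- Gibbs' inequality for a doubly stochastic `p` carrying the weights `l` to a bipartite
distribution with marginals `r` and `s`. -/
theorem sum_mul_log_add_sum_mul_log_le {ι m n : Type*} [Fintype ι] [Fintype m] [Fintype n]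
    {p : ι → m × n → ℝ} {l : ι → ℝ} {r : m → ℝ} {s : n → ℝ}
    (hp : ∀ i j, 0 ≤ p i j) (hrow : ∀ i, ∑ j, p i j = 1) (hcol : ∀ j, ∑ i, p i j = 1)
    (hl : ∀ i, 0 ≤ l i) (hl1 : ∑ i, l i = 1)
    (hr : ∀ a, ∑ b, ∑ i, l i * p i (a, b) = r a)
    (hs : ∀ b, ∑ a, ∑ i, l i * p i (a, b) = s b) :
    ∑ a, r a * Real.log (r a) + ∑ b, s b * Real.log (s b) ≤ ∑ i, l i * Real.log (l i) := by
  have hlp (i j) : 0 ≤ l i * p i j := mul_nonneg (hl i) (hp i j)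
  have hr0 (a) : 0 ≤ r a := hr a ▸ Finset.sum_nonneg fun b _ => Finset.sum_nonneg fun i _ => hlp _ _
  have hs0 (b) : 0 ≤ s b := hs b ▸ Finset.sum_nonneg fun a _ => Finset.sum_nonneg fun i _ => hlp _ _
  have hle (i a b) : l i * p i (a, b) ≤ r a := by
    rw [← hr a]
    refine le_trans ?_ (Finset.single_le_sum (f := fun b => ∑ i, l i * p i (a, b))
      (fun b _ => Finset.sum_nonneg fun i _ => hlp _ _) (Finset.mem_univ b))
    exact Finset.single_le_sum (f := fun i => l i * p i (a, b)) (fun i _ => hlp _ _)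
      (Finset.mem_univ i)
  have hle' (i a b) : l i * p i (a, b) ≤ s b := by
    rw [← hs b]
    refine le_trans ?_ (Finset.single_le_sum (f := fun a => ∑ i, l i * p i (a, b))
      (fun b _ => Finset.sum_nonneg fun i _ => hlp _ _) (Finset.mem_univ a))
    exact Finset.single_le_sum (f := fun i => l i * p i (a, b)) (fun i _ => hlp _ _)
      (Finset.mem_univ i)
  have hmass (f : ι → ℝ) : ∑ i, ∑ j, p i j * f i = ∑ i, f i := by
    simp only [← Finset.sum_mul, hrow, one_mul]
  have hr1 : ∑ a, r a = 1 := by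
    simp only [← hr]
    rw [← Fintype.sum_prod_type' (f := fun a b => ∑ i, l i * p i (a, b)), Finset.sum_comm]
    simp only [← Finset.mul_sum, hrow, mul_one, hl1]
  have hs1 : ∑ b, s b = 1 := by
    simp only [← hs]
    rw [← Fintype.sum_prod_type_right' (f := fun a b => ∑ i, l i * p i (a, b)), Finset.sum_comm]
    simp only [← Finset.mul_sum, hrow, mul_one, hl1]
  have hrlog : ∑ a, r a * Real.log (r a) = ∑ i, ∑ j, l i * p i j * Real.log (r j.1) := by
    rw [Finset.sum_comm, Fintype.sum_prod_type]
    simp only [← Finset.sum_mul, hr]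
  have hslog : ∑ b, s b * Real.log (s b) = ∑ i, ∑ j, l i * p i j * Real.log (s j.2) := by
    rw [Finset.sum_comm, Fintype.sum_prod_type_right]
    simp only [← Finset.sum_mul, hs]
  have hllog : ∑ i, l i * Real.log (l i) = ∑ i, ∑ j, l i * p i j * Real.log (l i) := by
    simp only [← Finset.sum_mul, ← Finset.mul_sum, hrow, mul_one]
  have hprod : ∑ i, ∑ j, p i j * (r j.1 * s j.2) = 1 := by
    rw [Finset.sum_comm]
    simp only [← Finset.sum_mul, hcol, one_mul, Fintype.sum_prod_type, ← Finset.mul_sum, hs1,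
      mul_one, hr1]
  have key : ∑ i, ∑ j, (p i j * l i - p i j * (r j.1 * s j.2)) ≤
      ∑ i, ∑ j, l i * p i j * (Real.log (l i) - Real.log (r j.1) - Real.log (s j.2)) :=
    Finset.sum_le_sum fun i _ => Finset.sum_le_sum fun j _ =>
      mul_sub_mul_le_mul_log (hp i j) (hl i) (hr0 _) (hs0 _)
        (fun h => le_antisymm (h ▸ hle i j.1 j.2) (hlp i j))
        (fun h => le_antisymm (h ▸ hle' i j.1 j.2) (hlp i j))
  simp only [mul_sub, Finset.sum_sub_distrib] at key
  rw [hmass, hprod, hl1, ← hllog, ← hrlog, ← hslog] at key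
  linarith

theorem neg_log_card_le_sum_mul_log {ι : Type*} [Fintype ι] {r : ι → ℝ} (hr : ∀ i, 0 ≤ r i)
    (hr1 : ∑ i, r i = 1) : -Real.log (Fintype.card ι) ≤ ∑ i, r i * Real.log (r i) := by
  rcases isEmpty_or_nonempty ι with _ | _
  · simp at hr1
  have hc : (0 : ℝ) < Fintype.card ι := by exact_mod_cast Fintype.card_pos
  have key : ∑ i, (1 * r i - 1 * ((Fintype.card ι : ℝ)⁻¹ * 1)) ≤
      ∑ i, r i * 1 * (Real.log (r i) - Real.log (Fintype.card ι : ℝ)⁻¹ - Real.log 1) :=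
    Finset.sum_le_sum fun i _ => mul_sub_mul_le_mul_log zero_le_one (hr i) (by positivity)
      zero_le_one (fun h => absurd h (by positivity)) (fun h => absurd h one_ne_zero)
  simp only [Real.log_inv, Real.log_one, mul_one, one_mul, sub_zero, sub_neg_eq_add, mul_add,
    Finset.sum_sub_distrib, Finset.sum_add_distrib, ← Finset.sum_mul, hr1, Finset.sum_const,
    Finset.card_univ, nsmul_eq_mul, mul_inv_cancel₀ hc.ne'] at key
  linarith

/-- `S_{A|B}(σ) ≤ S(σ_A) ≤ log₂ d`. -/
theorem condEntropy_le_entropy_A_le_logb {d : ℕ} (hd : 0 < d)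
    (σ : Matrix (Fin d × Fin d) (Fin d × Fin d) ℂ) (hσ : IsState σ) :
    condEntropy σ ≤ vnEntropy (ptraceA σ) ∧ vnEntropy (ptraceA σ) ≤ Real.logb 2 d := by
  obtain ⟨hpos, htr⟩ := hσ
  have hH := hpos.isHermitian
  have hA : (ptraceA σ).IsHermitian := by
    ext i j
    simp [ptraceA, hH.apply]
  have hB : (ptraceB σ).IsHermitian := by
    ext i j
    simp [ptraceB, hH.apply]
  set W : Matrix (Fin d × Fin d) (Fin d × Fin d) ℂ := (hH.eigenvectorUnitary).1
  set U : Matrix (Fin d) (Fin d) ℂ := (hA.eigenvectorUnitary).1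
  set V : Matrix (Fin d) (Fin d) ℂ := (hB.eigenvectorUnitary).1
  have hW := hH.eigenvectorUnitary.2
  have hU := hA.eigenvectorUnitary.2
  have hV := hB.eigenvectorUnitary.2
  have hUV : U ⊗ₖ V ∈ unitary _ := kronecker_mem_unitary hU hV
  set X := star W * (U ⊗ₖ V) with hX_def
  have hX : X ∈ unitary (Matrix (Fin d × Fin d) (Fin d × Fin d) ℂ) :=
    mul_mem (Unitary.star_mem hW) hUV
  have hconj : star (U ⊗ₖ V) * σ * (U ⊗ₖ V) =
      star X * diagonal (fun i => (hH.eigenvalues i : ℂ)) * X := by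
    have hWW : W * star W = 1 := hW.2
    rw [← hH.star_eigenvectorUnitary_mul_mul, hX_def, star_mul, star_star]
    change _ = star (U ⊗ₖ V) * W * (star W * σ * W) * (star W * (U ⊗ₖ V))
    calc _ = star (U ⊗ₖ V) * (W * star W) * σ * (W * star W) * (U ⊗ₖ V) := by simp [hWW]
      _ = _ := by simp only [mul_assoc]
  have hr (a) : ∑ b, ∑ i, hH.eigenvalues i * Complex.normSq (X i (a, b)) = hA.eigenvalues a := by
    have := sum_conj_kronecker_snd σ U hV.2 a
    rw [hA.star_eigenvectorUnitary_mul_mul, diagonal_apply_eq, hconj] at this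
    simp only [star_mul_diagonal_mul_apply_self] at this
    exact_mod_cast this
  have hs (b) : ∑ a, ∑ i, hH.eigenvalues i * Complex.normSq (X i (a, b)) = hB.eigenvalues b := by
    have := sum_conj_kronecker_fst σ V hU.2 b
    rw [hB.star_eigenvectorUnitary_mul_mul, diagonal_apply_eq, hconj] at this
    simp only [star_mul_diagonal_mul_apply_self] at this
    exact_mod_cast this
  have hl1 : ∑ i, hH.eigenvalues i = 1 := by
    have : ((1 : ℝ) : ℂ) = ∑ i, (hH.eigenvalues i : ℂ) := by
      rw [Complex.ofReal_one, ← htr]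
      exact hH.trace_eq_sum_eigenvalues
    exact_mod_cast this.symm
  have hα1 : ∑ a, hA.eigenvalues a = 1 := by
    have h_tr : (ptraceA σ).trace = σ.trace := by
      simp [trace, ptraceA, Fintype.sum_prod_type]
    have : ((1 : ℝ) : ℂ) = ∑ i, (hA.eigenvalues i : ℂ) := by
      rw [Complex.ofReal_one, ← htr, ← h_tr]
      exact hA.trace_eq_sum_eigenvalues
    exact_mod_cast this.symm
  have hα0 (a) : 0 ≤ hA.eigenvalues a := by
    rw [← hr a]
    exact Finset.sum_nonneg fun b _ => Finset.sum_nonneg fun i _ =>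
      mul_nonneg (hpos.eigenvalues_nonneg i) (Complex.normSq_nonneg _)
  have hlog2 : 0 < Real.log 2 := Real.log_pos one_lt_two
  constructor
  · have := sum_mul_log_add_sum_mul_log_le (p := fun i j => Complex.normSq (X i j))
      (fun i j => Complex.normSq_nonneg _) (sum_normSq_row hX.2) (sum_normSq_col hX.1)
      hpos.eigenvalues_nonneg hl1 hr hs
    rw [condEntropy, vnEntropy_eq_log hH, vnEntropy_eq_log hA, vnEntropy_eq_log hB, ← sub_div]
    gcongr
    linarith
  · have := neg_log_card_le_sum_mul_log hα0 hα1
    rw [Fintype.card_fin] at this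
    rw [vnEntropy_eq_log hA, Real.logb]
    gcongr
    linarith
end
end

section
/- The set CVENN = {σ : σ is a state on ℂ^d ⊗ ℂ^d and S_{A|B}(σ) ≥ 0} is a closed subset of the space of d²×d² complex matrices. -/
open scoped Kronecker ComplexOrder
open Matrix

noncomputable section

open scoped Matrix.Norms.L2Operator in
/-- On Hermitian matrices, the functional calculus of a continuous function is continuous. -/
lemma continuousOn_cfc_isHermitian {n : Type*} [Fintype n] [DecidableEq n] {f : ℝ → ℝ}
    (hf : Continuous f) :
    ContinuousOn (fun M : Matrix n n ℂ => cfc f M) {M | M.IsHermitian} :=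
  ContinuousOn.cfc_of_mem_nhdsSet (s := Set.univ) f Filter.univ_mem
    continuousOn_id (fun _ hx => hx) hf.continuousOn

lemma vnEntropy_eq_re_trace_cfc {n : Type*} [Fintype n] [DecidableEq n] {M : Matrix n n ℂ}
    (hM : M.IsHermitian) :
    vnEntropy M = (cfc (fun x : ℝ => -(x * Real.logb 2 x)) M).trace.re := by
  rw [hM.cfc_eq, IsHermitian.cfc, Unitary.conjStarAlgAut_apply, trace_mul_comm, ← mul_assoc,
    Unitary.coe_star_mul_self, one_mul, trace_diagonal, vnEntropy, dif_pos hM]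
  simp

lemma continuousOn_vnEntropy {n : Type*} [Fintype n] [DecidableEq n] :
    ContinuousOn (fun M : Matrix n n ℂ => vnEntropy M) {M | M.IsHermitian} := by
  have hf : Continuous fun x : ℝ => -(x * Real.logb 2 x) := by
    simp only [Real.logb, ← mul_div_assoc]
    exact (Real.continuous_mul_log.div_const _).neg
  have htr : Continuous fun M : Matrix n n ℂ => M.trace.re :=
    Complex.continuous_re.comp continuous_id.matrix_trace
  exact (htr.comp_continuousOn (continuousOn_cfc_isHermitian hf)).congr
    fun M hM => vnEntropy_eq_re_trace_cfc hM

lemma Matrix.IsHermitian.ptraceB {d : ℕ} {ρ : Matrix (Fin d × Fin d) (Fin d × Fin d) ℂ}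
    (h : ρ.IsHermitian) : (ptraceB ρ).IsHermitian := by
  ext k l
  simp only [_root_.ptraceB, conjTranspose_apply, of_apply, star_sum, h.apply]

lemma continuous_ptraceB {d : ℕ} :
    Continuous (ptraceB : Matrix (Fin d × Fin d) (Fin d × Fin d) ℂ → _) :=
  continuous_matrix fun k l => by
    simp only [ptraceB, of_apply]
    exact continuous_finsetSum _ fun i _ => continuous_id.matrix_elem (i, k) (i, l)

lemma isClosed_setOf_posSemidef {n : Type*} [Fintype n] :
    IsClosed {M : Matrix n n ℂ | M.PosSemidef} := by
  simp only [posSemidef_iff_dotProduct_mulVec, Set.ofPred_and, Set.ofPred_forall]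
  refine (isClosed_eq continuous_id.matrix_conjTranspose continuous_id).inter
    (isClosed_iInter fun x => isClosed_le continuous_const ?_)
  exact continuous_const.dotProduct (continuous_id.matrix_mulVec continuous_const)

/-- CVENN is a closed subset of the space of `d²×d²` complex matrices. -/
theorem cvenn_isClosed {d : ℕ} (hd : 0 < d) :
    IsClosed {σ : Matrix (Fin d × Fin d) (Fin d × Fin d) ℂ | IsState σ ∧ 0 ≤ condEntropy σ} := by
  have hstate : IsClosed {σ : Matrix (Fin d × Fin d) (Fin d × Fin d) ℂ | IsState σ} :=
    isClosed_setOf_posSemidef.inter (isClosed_eq continuous_id.matrix_trace continuous_const)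
  have hcond : ContinuousOn (fun σ : Matrix (Fin d × Fin d) (Fin d × Fin d) ℂ => condEntropy σ)
      {σ | IsState σ} :=
    (continuousOn_vnEntropy.mono fun σ hσ => hσ.1.isHermitian).sub
      (continuousOn_vnEntropy.comp continuous_ptraceB.continuousOn
        fun σ hσ => hσ.1.isHermitian.ptraceB)
  exact hcond.preimage_isClosed_of_isClosed hstate isClosed_Ici
end
end

section
/- Every separable state has non-negative conditional von Neumann entropy: if ρ = ∑_{i=1}^n p_i · (σ_i ⊗ τ_i) where p_i ≥ 0, ∑_i p_i = 1, and each σ_i, τ_i is a d×d positive semidefinite matrix of trace 1, then S_{A|B}(ρ) ≥ 0. Equivalently, every state with negative conditional von Neumann entropy is entangled. -/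
open scoped Kronecker ComplexOrder
open Matrix

noncomputable section

namespace Matrix

variable {n : Type*} [Fintype n]

/-- A positive semidefinite matrix of trace one is at most the identity. -/
lemma PosSemidef.one_sub_of_trace_eq_one [DecidableEq n] {A : Matrix n n ℂ} (hA : A.PosSemidef)
    (htr : A.trace = 1) : (1 - A).PosSemidef := by
  have hsum : ∑ i, hA.isHermitian.eigenvalues i = 1 := by
    have h := hA.isHermitian.trace_eq_sum_eigenvalues
    rw [htr] at h
    apply Complex.ofReal_injective
    rw [Complex.ofReal_sum]
    exact h.symm
  have hle (i : n) : hA.isHermitian.eigenvalues i ≤ 1 := by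
    rw [← hsum]
    exact Finset.single_le_sum (fun j _ => hA.eigenvalues_nonneg j) (Finset.mem_univ i)
  set U : Matrix n n ℂ := hA.isHermitian.eigenvectorUnitary.1
  have hU : U * star U = 1 := Unitary.coe_mul_star_self _
  have hspec : A = U * diagonal (fun i => (hA.isHermitian.eigenvalues i : ℂ)) * star U := by
    conv_lhs => rw [hA.isHermitian.spectral_theorem, Unitary.conjStarAlgAut_apply]
    rfl
  have heq : 1 - A = U * diagonal (fun i => 1 - (hA.isHermitian.eigenvalues i : ℂ)) * Uᴴ := by
    rw [← diagonal_sub, diagonal_one, mul_sub, sub_mul, mul_one, ← star_eq_conjTranspose, hU,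
      ← hspec]
  rw [heq]
  refine PosSemidef.mul_mul_conjTranspose_same (PosSemidef.diagonal fun i => ?_) U
  exact sub_nonneg.2 (Complex.real_le_real.2 (hle i))

/-- The scalar estimate behind operator monotonicity of the logarithm, for weights `a`. -/
lemma mul_logb_le_sum_of_mul_sq_le {r : ℝ} (hr : 0 ≤ r) {a w : n → ℝ} (ha : ∀ k, 0 ≤ a k)
    (hw : ∀ k, 0 ≤ w k) (hsum : ∑ k, a k = 1) (hle : ∀ k, r * a k ≤ w k)
    (hsq : r * (∑ k, a k * (w k)⁻¹) ^ 2 ≤ ∑ k, a k * (w k)⁻¹) :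
    r * Real.logb 2 r ≤ ∑ k, r * a k * Real.logb 2 (w k) := by
  rcases hr.eq_or_lt with rfl | hr
  · simp
  set t := ∑ k, a k * (w k)⁻¹ with ht
  have ht0 : 0 ≤ t := Finset.sum_nonneg fun k _ => mul_nonneg (ha k) (inv_nonneg.2 (hw k))
  have hrt : r * t ≤ 1 := by
    rcases ht0.eq_or_lt with h | h
    · rw [← h]; simp
    · nlinarith
  have hterm (k : n) : a k - r * (a k * (w k)⁻¹) ≤ a k * (Real.log (w k) - Real.log r) := by
    rcases (hw k).eq_or_lt with h | h
    · have hak : a k = 0 := by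
        have := hle k
        rw [← h] at this
        nlinarith [ha k]
      simp [hak]
    · have hlog := Real.one_sub_inv_le_log_of_pos (div_pos h hr)
      rw [Real.log_div h.ne' hr.ne', inv_div] at hlog
      calc a k - r * (a k * (w k)⁻¹) = a k * (1 - r / w k) := by ring
        _ ≤ _ := mul_le_mul_of_nonneg_left hlog (ha k)
  have hmain : 0 ≤ ∑ k, a k * (Real.log (w k) - Real.log r) := by
    refine le_trans ?_ (Finset.sum_le_sum fun k _ => hterm k)
    rw [Finset.sum_sub_distrib, hsum, ← Finset.mul_sum]
    linarith
  have hlog : Real.log r ≤ ∑ k, a k * Real.log (w k) := by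
    simp only [mul_sub, Finset.sum_sub_distrib, ← Finset.sum_mul, hsum] at hmain
    linarith
  have heq : ∑ k, r * a k * Real.logb 2 (w k) = r * (∑ k, a k * Real.log (w k)) / Real.log 2 := by
    rw [Finset.mul_sum, Finset.sum_div]
    refine Finset.sum_congr rfl fun k _ => ?_
    rw [Real.logb]
    ring
  rw [heq, Real.logb, ← mul_div_assoc]
  have h2 : 0 ≤ Real.log 2 := (Real.log_pos one_lt_two).le
  gcongr

/-- If `Cᴴ * diagonal r * C ≤ diagonal w` with `C` unitary, then `∑ r log r` is at most the trace
of `Cᴴ * diagonal r * C` times the logarithm of `diagonal w`. -/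
lemma sum_mul_logb_le_of_posSemidef_sub [DecidableEq n] {C : Matrix n n ℂ} (hC : C * Cᴴ = 1)
    {r w : n → ℝ} (hr : ∀ j, 0 ≤ r j) (hw : ∀ k, 0 ≤ w k)
    (hle : (diagonal (fun k => (w k : ℂ)) -
      Cᴴ * diagonal (fun j => (r j : ℂ)) * C).PosSemidef) :
    ∑ j, r j * Real.logb 2 (r j) ≤
      ∑ k, ((Cᴴ * diagonal (fun j => (r j : ℂ)) * C) k k).re * Real.logb 2 (w k) := by
  have hquad (j : n) (y : n → ℂ) :
      r j * Complex.normSq ((C *ᵥ y) j) ≤ ∑ k, w k * Complex.normSq (y k) := by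
    have h := hle.dotProduct_mulVec_nonneg y
    have hD (v : n → ℝ) (z : n → ℂ) : star z ⬝ᵥ (diagonal (fun k => (v k : ℂ)) *ᵥ z) =
        ((∑ k, v k * Complex.normSq (z k) : ℝ) : ℂ) := by
      push_cast
      refine Finset.sum_congr rfl fun k _ => ?_
      rw [mulVec_diagonal, Complex.normSq_eq_conj_mul_self, Pi.star_apply, Complex.star_def]
      ring
    have hCD : star y ⬝ᵥ ((Cᴴ * diagonal (fun j => (r j : ℂ)) * C) *ᵥ y) =
        star (C *ᵥ y) ⬝ᵥ (diagonal (fun j => (r j : ℂ)) *ᵥ (C *ᵥ y)) := by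
      rw [star_mulVec, ← dotProduct_mulVec, mulVec_mulVec, mulVec_mulVec, mul_assoc]
    rw [sub_mulVec, dotProduct_sub, hCD, hD, hD, ← Complex.ofReal_sub] at h
    have h' : 0 ≤ ∑ k, w k * Complex.normSq (y k) - ∑ k, r k * Complex.normSq ((C *ᵥ y) k) := by
      exact_mod_cast h
    refine le_trans ?_ (sub_nonneg.1 h')
    exact Finset.single_le_sum (f := fun k => r k * Complex.normSq ((C *ᵥ y) k))
      (fun k _ => mul_nonneg (hr k) (Complex.normSq_nonneg _)) (Finset.mem_univ j)
  have hdiag (k : n) : ((Cᴴ * diagonal (fun j => (r j : ℂ)) * C) k k).re =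
      ∑ j, r j * Complex.normSq (C j k) := by
    rw [mul_apply, Complex.re_sum]
    refine Finset.sum_congr rfl fun j _ => ?_
    rw [mul_diagonal, conjTranspose_apply, Complex.star_def, mul_right_comm,
      ← Complex.normSq_eq_conj_mul_self, ← Complex.ofReal_mul, Complex.ofReal_re, mul_comm]
  simp only [hdiag, Finset.sum_mul]
  rw [Finset.sum_comm]
  refine Finset.sum_le_sum fun j _ => ?_
  refine mul_logb_le_sum_of_mul_sq_le (hr j) (fun k => Complex.normSq_nonneg _) hw ?_ ?_ ?_
  · have h := congrFun (congrFun hC j) j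
    simp only [mul_apply, conjTranspose_apply, one_apply_eq, Complex.star_def,
      Complex.mul_conj] at h
    exact_mod_cast h
  · intro k
    have h := hquad j (Pi.single k 1)
    simpa [Pi.single_apply, apply_ite Complex.normSq] using h
  · have h := hquad j (fun k => star (C j k) * ((w k)⁻¹ : ℝ))
    have h1 : (C *ᵥ (fun k => star (C j k) * (((w k)⁻¹ : ℝ) : ℂ))) j =
        ((∑ k, Complex.normSq (C j k) * (w k)⁻¹ : ℝ) : ℂ) := by
      push_cast
      refine Finset.sum_congr rfl fun k _ => ?_
      rw [Complex.star_def, ← mul_assoc, Complex.mul_conj]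
    have h2 : ∑ k, w k * Complex.normSq (star (C j k) * (((w k)⁻¹ : ℝ) : ℂ)) =
        ∑ k, Complex.normSq (C j k) * (w k)⁻¹ := by
      refine Finset.sum_congr rfl fun k _ => ?_
      rw [Complex.normSq_mul, Complex.star_def, Complex.normSq_conj, Complex.normSq_ofReal]
      rcases eq_or_ne (w k) 0 with hk | hk
      · simp [hk]
      · field_simp
    rw [h1, h2, Complex.normSq_ofReal, ← sq] at h
    exact h

end Matrix

/-- A state dominated by `1 ⊗ ρ_B` has non-negative conditional entropy. -/
lemma condEntropy_nonneg_of_le {d : ℕ} {ρ : Matrix (Fin d × Fin d) (Fin d × Fin d) ℂ}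
    (hρ : ρ.PosSemidef) (hB : (ptraceB ρ).PosSemidef)
    (hle : ((1 : Matrix (Fin d) (Fin d) ℂ) ⊗ₖ ptraceB ρ - ρ).PosSemidef) :
    0 ≤ condEntropy ρ := by
  set U : Matrix (Fin d × Fin d) (Fin d × Fin d) ℂ := hρ.isHermitian.eigenvectorUnitary.1
  set W : Matrix (Fin d) (Fin d) ℂ := hB.isHermitian.eigenvectorUnitary.1
  set r := hρ.isHermitian.eigenvalues
  set s := hB.isHermitian.eigenvalues
  set V : Matrix (Fin d × Fin d) (Fin d × Fin d) ℂ := (1 : Matrix (Fin d) (Fin d) ℂ) ⊗ₖ W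
  have hUU : Uᴴ * U = 1 := Unitary.coe_star_mul_self _
  have hWW : W * Wᴴ = 1 := Unitary.coe_mul_star_self _
  have hVV : V * Vᴴ = 1 := by
    rw [conjTranspose_kronecker, ← mul_kronecker_mul, hWW, conjTranspose_one, mul_one,
      one_kronecker_one]
  have hspec : ρ = U * diagonal (fun i => (r i : ℂ)) * Uᴴ := by
    conv_lhs => rw [hρ.isHermitian.spectral_theorem, Unitary.conjStarAlgAut_apply]
    rfl
  have hspecB : Wᴴ * ptraceB ρ * W = diagonal (fun i => (s i : ℂ)) := by
    have h := hB.isHermitian.conjStarAlgAut_star_eigenvectorUnitary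
    rw [Unitary.conjStarAlgAut_star_apply] at h
    exact h
  have hconj : (Uᴴ * V)ᴴ * diagonal (fun i => (r i : ℂ)) * (Uᴴ * V) = Vᴴ * ρ * V := by
    conv_rhs => rw [hspec]
    simp only [conjTranspose_mul, conjTranspose_conjTranspose, mul_assoc]
  have hconjB : Vᴴ * ((1 : Matrix (Fin d) (Fin d) ℂ) ⊗ₖ ptraceB ρ) * V =
      diagonal (fun x : Fin d × Fin d => (s x.2 : ℂ)) := by
    rw [conjTranspose_kronecker, ← mul_kronecker_mul, ← mul_kronecker_mul, hspecB,
      conjTranspose_one, mul_one, mul_one, ← diagonal_one, diagonal_kronecker_diagonal]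
    simp
  have hC : (Uᴴ * V) * (Uᴴ * V)ᴴ = 1 := by
    rw [conjTranspose_mul, conjTranspose_conjTranspose, mul_assoc, ← mul_assoc V, hVV, one_mul,
      hUU]
  have hsub : (diagonal (fun x : Fin d × Fin d => (s x.2 : ℂ)) -
      (Uᴴ * V)ᴴ * diagonal (fun i => (r i : ℂ)) * (Uᴴ * V)).PosSemidef := by
    rw [hconj, ← hconjB, ← sub_mul, ← mul_sub]
    exact hle.conjTranspose_mul_mul_same V
  have hmain := sum_mul_logb_le_of_posSemidef_sub (w := fun x : Fin d × Fin d => s x.2) hC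
    hρ.eigenvalues_nonneg (fun x => hB.eigenvalues_nonneg x.2) hsub
  have hpt (k : Fin d) : ∑ i, (Vᴴ * ρ * V) (i, k) (i, k) = s k := by
    have h := congrFun (congrFun hspecB k) k
    rw [diagonal_apply_eq] at h
    rw [← h]
    simp only [V, mul_apply, conjTranspose_apply, kroneckerMap_apply, Fintype.sum_prod_type,
      one_apply, ptraceB, of_apply, Finset.sum_mul, Finset.mul_sum, ite_mul, mul_ite, one_mul,
      zero_mul, mul_zero, apply_ite star, star_zero, Finset.sum_ite_irrel,
      Finset.sum_const_zero, Finset.sum_ite_eq', Finset.mem_univ, if_true]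
    rw [Finset.sum_comm]
    refine Finset.sum_congr rfl fun l _ => ?_
    rw [Finset.sum_comm]
  have hrhs : ∑ x : Fin d × Fin d, ((Vᴴ * ρ * V) x x).re * Real.logb 2 (s x.2) =
      ∑ k, s k * Real.logb 2 (s k) := by
    rw [Fintype.sum_prod_type_right]
    refine Finset.sum_congr rfl fun k _ => ?_
    dsimp only
    rw [← Finset.sum_mul, ← Complex.re_sum, hpt, Complex.ofReal_re]
  rw [hconj, hrhs] at hmain
  rw [condEntropy, vnEntropy, vnEntropy, dif_pos hρ.isHermitian, dif_pos hB.isHermitian]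
  linarith

/-- every separable state has non-negative conditional von Neumann entropy. -/
theorem separable_nonneg_condEntropy {d n : ℕ} (hd : 0 < d)
    (p : Fin n → ℝ) (hp : ∀ i, 0 ≤ p i) (hpsum : ∑ i, p i = 1)
    (σ τ : Fin n → Matrix (Fin d) (Fin d) ℂ)
    (hσ : ∀ i, (σ i).PosSemidef) (hσtr : ∀ i, (σ i).trace = 1)
    (hτ : ∀ i, (τ i).PosSemidef) (hτtr : ∀ i, (τ i).trace = 1) :
    0 ≤ condEntropy (∑ i, (p i : ℂ) • (σ i ⊗ₖ τ i)) := by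
  have hpC (i : Fin n) : (0 : ℂ) ≤ p i := by exact_mod_cast hp i
  have hB : ptraceB (∑ i, (p i : ℂ) • (σ i ⊗ₖ τ i)) = ∑ i, (p i : ℂ) • τ i := by
    ext k l
    simp only [ptraceB, of_apply, Matrix.sum_apply, Matrix.smul_apply, kroneckerMap_apply,
      smul_eq_mul]
    rw [Finset.sum_comm]
    refine Finset.sum_congr rfl fun i _ => ?_
    have h := hσtr i
    simp only [trace, diag_apply] at h
    rw [← Finset.mul_sum, ← Finset.sum_mul, h, one_mul]
  refine condEntropy_nonneg_of_le ?_ ?_ ?_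
  · exact posSemidef_sum _ fun i _ => ((hσ i).kronecker (hτ i)).smul (hpC i)
  · rw [hB]
    exact posSemidef_sum _ fun i _ => (hτ i).smul (hpC i)
  · have heq : (1 : Matrix (Fin d) (Fin d) ℂ) ⊗ₖ (∑ i, (p i : ℂ) • τ i) -
        ∑ i, (p i : ℂ) • (σ i ⊗ₖ τ i) = ∑ i, (p i : ℂ) • ((1 - σ i) ⊗ₖ τ i) := by
      ext x y
      simp only [Matrix.sub_apply, Matrix.sum_apply, Matrix.smul_apply, kroneckerMap_apply,
        smul_eq_mul, Finset.mul_sum, ← Finset.sum_sub_distrib]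
      refine Finset.sum_congr rfl fun i _ => ?_
      ring
    rw [hB, heq]
    exact posSemidef_sum _ fun i _ =>
      (((hσ i).one_sub_of_trace_eq_one (hσtr i)).kronecker (hτ i)).smul (hpC i)
end
end

section
/- The Werner state ρ_Wer = 0.99·|φ⁺⟩⟨φ⁺| + 0.01·(I/4) on ℂ² ⊗ ℂ², where |φ⁺⟩ = (|00⟩ + |11⟩)/√2 and I is the 4×4 identity, has negative conditional von Neumann entropy: S_{A|B}(ρ_Wer) < 0. -/
open scoped Kronecker ComplexOrder
open Matrix

noncomputable section

/-- The projector onto `|φ⁺⟩ = (|00⟩ + |11⟩)/√2`. -/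
def phiPlusProj2 : Matrix (Fin 2 × Fin 2) (Fin 2 × Fin 2) ℂ :=
  Matrix.of fun p q => if p.1 = p.2 ∧ q.1 = q.2 then (1 / 2 : ℂ) else 0

/-- The Werner state `0.99·|φ⁺⟩⟨φ⁺| + 0.01·I/4`. -/
def wernerState : Matrix (Fin 2 × Fin 2) (Fin 2 × Fin 2) ℂ :=
  (0.99 : ℂ) • phiPlusProj2 + (0.01 : ℂ) • ((4 : ℂ)⁻¹ • 1)

/-- Eigenvalues of a Hermitian matrix annihilated by a monic quadratic are among its roots. -/
theorem Matrix.IsHermitian.eigenvalues_eq_or_eq_of_mul_self {n : Type*} [Fintype n]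
    [DecidableEq n] {M : Matrix n n ℂ} (hM : M.IsHermitian) {a b : ℝ}
    (h : M * M = ((a + b : ℝ) : ℂ) • M - ((a * b : ℝ) : ℂ) • 1) (i : n) :
    hM.eigenvalues i = a ∨ hM.eigenvalues i = b := by
  set v : n → ℂ := (hM.eigenvectorBasis i).ofLp
  have hv : M *ᵥ v = (hM.eigenvalues i : ℂ) • v := by
    simpa using hM.mulVec_eigenvectorBasis i
  have hv0 : v ≠ 0 := fun h0 =>
    hM.eigenvectorBasis.toBasis.ne_zero i (by simpa [v] using h0)
  obtain ⟨j, hj⟩ := Function.ne_iff.mp hv0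
  have key := congrFun (congrArg (· *ᵥ v) h) j
  simp only [← mulVec_mulVec, sub_mulVec, smul_mulVec, one_mulVec, hv, mulVec_smul,
    Pi.sub_apply, Pi.smul_apply, smul_eq_mul] at key
  have hj' : v j ≠ 0 := hj
  have hc : ((hM.eigenvalues i : ℂ) - a) * ((hM.eigenvalues i : ℂ) - b) = 0 := by
    apply mul_right_cancel₀ hj'
    push_cast at key
    linear_combination key
  have hr : (hM.eigenvalues i - a) * (hM.eigenvalues i - b) = 0 := by exact_mod_cast hc
  rcases mul_eq_zero.mp hr with h1 | h1
  · exact .inl (sub_eq_zero.mp h1)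
  · exact .inr (sub_eq_zero.mp h1)

theorem wernerState_isHermitian : wernerState.IsHermitian := by
  have h1 : (starRingEnd ℂ) 0.99 = 0.99 := by
    rw [show (0.99 : ℂ) = ((99 / 100 : ℝ) : ℂ) by norm_num, Complex.conj_ofReal]
  have h2 : (starRingEnd ℂ) 0.01 = 0.01 := by
    rw [show (0.01 : ℂ) = ((1 / 100 : ℝ) : ℂ) by norm_num, Complex.conj_ofReal]
  ext ⟨i, k⟩ ⟨j, l⟩
  fin_cases i <;> fin_cases j <;> fin_cases k <;> fin_cases l <;>
    simp [wernerState, phiPlusProj2, h1, h2]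

theorem wernerState_mul_self :
    wernerState * wernerState =
      ((397 / 400 + 1 / 400 : ℝ) : ℂ) • wernerState - ((397 / 400 * (1 / 400) : ℝ) : ℂ) • 1 := by
  ext ⟨i, k⟩ ⟨j, l⟩
  fin_cases i <;> fin_cases j <;> fin_cases k <;> fin_cases l <;>
    simp [wernerState, phiPlusProj2, Matrix.one_apply, Matrix.mul_apply,
      Fintype.sum_prod_type] <;> norm_num

theorem ptraceB_wernerState : ptraceB wernerState = (1 / 2 : ℂ) • 1 := by
  ext k l
  fin_cases k <;> fin_cases l <;>
    simp [ptraceB, wernerState, phiPlusProj2, Matrix.one_apply] <;> norm_num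

/-- The maximally mixed qubit state has entropy `1`. -/
theorem vnEntropy_half_smul_one :
    vnEntropy ((1 / 2 : ℂ) • (1 : Matrix (Fin 2) (Fin 2) ℂ)) = 1 := by
  have hM : ((1 / 2 : ℂ) • (1 : Matrix (Fin 2) (Fin 2) ℂ)).IsHermitian := by
    ext i j
    fin_cases i <;> fin_cases j <;> simp
  have he (i : Fin 2) : hM.eigenvalues i = 1 / 2 :=
    or_self_iff.mp <| hM.eigenvalues_eq_or_eq_of_mul_self (by
      ext i j
      fin_cases i <;> fin_cases j <;> simp <;> norm_num) i
  have hl : Real.logb 2 (1 / 2) = -1 := by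
    rw [one_div, Real.logb_inv, Real.logb_self_eq_one one_lt_two]
  rw [vnEntropy, dif_pos hM]
  simp only [he, hl, Fin.sum_univ_two]
  norm_num

theorem vnEntropy_wernerState_lt_one : vnEntropy wernerState < 1 := by
  have ha : (-1 / 5 : ℝ) ≤ Real.logb 2 (397 / 400) := by
    have h : Real.logb 2 ((2 : ℝ)⁻¹) ≤ Real.logb 2 ((397 / 400) ^ 5) :=
      Real.logb_le_logb_of_le one_lt_two (by norm_num) (by norm_num)
    rw [Real.logb_inv, Real.logb_pow, Real.logb_self_eq_one one_lt_two] at h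
    norm_num at h ⊢
    linarith
  have hb : (-9 : ℝ) ≤ Real.logb 2 (1 / 400) := by
    have h : Real.logb 2 ((2 : ℝ) ^ 9)⁻¹ ≤ Real.logb 2 (1 / 400) :=
      Real.logb_le_logb_of_le one_lt_two (by norm_num) (by norm_num)
    rw [Real.logb_inv, Real.logb_pow, Real.logb_self_eq_one one_lt_two] at h
    norm_num at h ⊢
    linarith
  have hM := wernerState_isHermitian
  have hterm (i : Fin 2 × Fin 2) :
      (-1 / 5 : ℝ) ≤ hM.eigenvalues i * Real.logb 2 (hM.eigenvalues i) := by
    rcases hM.eigenvalues_eq_or_eq_of_mul_self wernerState_mul_self i with h | h <;>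
      rw [h] <;> linarith
  have hsum := Finset.card_nsmul_le_sum Finset.univ _ _ fun i _ => hterm i
  rw [vnEntropy, dif_pos hM]
  norm_num at hsum ⊢
  linarith

/-- the Werner state has negative conditional von Neumann entropy. -/
theorem werner_negative_condEntropy : condEntropy wernerState < 0 := by
  rw [condEntropy, ptraceB_wernerState, vnEntropy_half_smul_one]
  exact sub_neg.mpr vnEntropy_wernerState_lt_one
end
end

section
/- The witness is not universal: in dimension d = 3, let ρ_Iso = 0.8·|Φ⁺⟩⟨Φ⁺| + 0.2·(I/9) and ρ_t = 0.715·|Φ⁺⟩⟨Φ⁺| + 0.285·(I/9), where |Φ⁺⟩ = (1/√3)∑_{i=0}^{2} |ii⟩ and I is the 9×9 identity, and let W = −log₂(ρ_Iso) − (log₂ 3)·I be the witness constructed from ρ_Iso. Then S_{A|B}(ρ_t) < 0 but Tr(W·ρ_t) > 0, so W fails to detect the negative conditional entropy of ρ_t. -/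
open scoped Kronecker ComplexOrder
open Matrix

noncomputable section

/-- The projector onto `|Φ⁺⟩ = (1/√3)∑ᵢ |ii⟩` in dimension 3. -/
def phiPlusProj3 : Matrix (Fin 3 × Fin 3) (Fin 3 × Fin 3) ℂ :=
  Matrix.of fun p q => if p.1 = p.2 ∧ q.1 = q.2 then (1 / 3 : ℂ) else 0

/-- The isotropic state `0.8·|Φ⁺⟩⟨Φ⁺| + 0.2·I/9`. -/
def rhoIso3 : Matrix (Fin 3 × Fin 3) (Fin 3 × Fin 3) ℂ :=
  (0.8 : ℂ) • phiPlusProj3 + (0.2 : ℂ) • ((9 : ℂ)⁻¹ • 1)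

/-- The test state `0.715·|Φ⁺⟩⟨Φ⁺| + 0.285·I/9`. -/
def rhoT3 : Matrix (Fin 3 × Fin 3) (Fin 3 × Fin 3) ℂ :=
  (0.715 : ℂ) • phiPlusProj3 + (0.285 : ℂ) • ((9 : ℂ)⁻¹ • 1)

/-- The witness `W = −log₂ ρ_Iso − (log₂ 3)·I` constructed from `ρ_Iso`. -/
def witness3 : Matrix (Fin 3 × Fin 3) (Fin 3 × Fin 3) ℂ :=
  -(matLog2 rhoIso3) - (Real.logb 2 3 : ℂ) • 1

variable {n : Type*} [DecidableEq n]

theorem isHermitian_real_smul_add {P : Matrix n n ℂ} (hP : P.IsHermitian) (x y : ℝ) :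
    ((x : ℂ) • P + (y : ℂ) • (1 : Matrix n n ℂ)).IsHermitian := by
  simp [IsHermitian, conjTranspose_add, conjTranspose_smul, hP.eq]

variable [Fintype n]

/-- The eigenvalues of `x P + y I`, with `P` idempotent, lie in `{x + y, y}`. -/
theorem eigenvalues_smul_idempotent_add {P : Matrix n n ℂ} (hP : P * P = P) (x y : ℝ)
    (h : ((x : ℂ) • P + (y : ℂ) • (1 : Matrix n n ℂ)).IsHermitian) (i : n) :
    h.eigenvalues i = x + y ∨ h.eigenvalues i = y := by
  set M := (x : ℂ) • P + (y : ℂ) • (1 : Matrix n n ℂ) with hM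
  set v : n → ℂ := ⇑(h.eigenvectorBasis i) with hv
  have hv0 : v ≠ 0 := by
    intro h0
    exact h.eigenvectorBasis.orthonormal.ne_zero i (by ext j; exact congrFun h0 j)
  have hMv : M *ᵥ v = (h.eigenvalues i : ℂ) • v := by
    ext j
    simpa using congrFun (h.mulVec_eigenvectorBasis i) j
  have hquad : M * M = ((x : ℂ) + 2 * y) • M - ((x + y) * y : ℂ) • (1 : Matrix n n ℂ) := by
    simp only [hM, add_mul, mul_add, smul_mul_assoc, mul_smul_comm, mul_one, one_mul, hP]
    module
  have hvec := congrArg (· *ᵥ v) hquad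
  simp only [← mulVec_mulVec, sub_mulVec, smul_mulVec, one_mulVec, hMv, mulVec_smul] at hvec
  obtain ⟨j, hj⟩ := Function.ne_iff.mp hv0
  have hj' := congrFun hvec j
  simp only [Pi.smul_apply, Pi.sub_apply, smul_eq_mul] at hj'
  have hroot : ((h.eigenvalues i : ℂ) - (x + y)) * (h.eigenvalues i - y) = 0 :=
    mul_right_cancel₀ hj (by linear_combination hj')
  rcases mul_eq_zero.mp hroot with h1 | h1
  · left; exact_mod_cast sub_eq_zero.mp h1
  · right; exact_mod_cast sub_eq_zero.mp h1

/-- Functional calculus of `x P + y I`, with `P` idempotent. -/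
theorem conj_diagonal_smul_idempotent_add {P : Matrix n n ℂ} (hP : P * P = P) (x y : ℝ)
    (h : ((x : ℂ) • P + (y : ℂ) • (1 : Matrix n n ℂ)).IsHermitian) (f : ℝ → ℝ) :
    (h.eigenvectorUnitary : Matrix n n ℂ) *
      diagonal (fun i => (f (h.eigenvalues i) : ℂ)) *
      star (h.eigenvectorUnitary : Matrix n n ℂ) =
    ((f (x + y) - f y : ℝ) : ℂ) • P + (f y : ℂ) • (1 : Matrix n n ℂ) := by
  set a : ℝ := (f (x + y) - f y) / x with ha
  have hax : a * x = f (x + y) - f y := by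
    by_cases hx : x = 0
    · simp [hx]
    · rw [ha, div_mul_cancel₀ _ hx]
  have hdiag : diagonal (fun i => (f (h.eigenvalues i) : ℂ)) =
      (a : ℂ) • diagonal (fun i => (h.eigenvalues i : ℂ)) +
        ((f y - a * y : ℝ) : ℂ) • (1 : Matrix n n ℂ) := by
    ext i j
    rcases eq_or_ne i j with rfl | hij
    swap
    · simp [hij]
    have : f (h.eigenvalues i) = a * h.eigenvalues i + (f y - a * y) := by
      rcases eigenvalues_smul_idempotent_add hP x y h i with hi | hi <;> rw [hi]
      · linear_combination -hax
      · ring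
    simp [this]
  have hspec : (h.eigenvectorUnitary : Matrix n n ℂ) *
      diagonal (fun i => (h.eigenvalues i : ℂ)) *
      star (h.eigenvectorUnitary : Matrix n n ℂ) = (x : ℂ) • P + (y : ℂ) • 1 := by
    conv_rhs => rw [h.spectral_theorem, Unitary.conjStarAlgAut_apply]
    rfl
  have hU : (h.eigenvectorUnitary : Matrix n n ℂ) *
      star (h.eigenvectorUnitary : Matrix n n ℂ) = 1 := Unitary.coe_mul_star_self _
  rw [hdiag, mul_add, add_mul, mul_smul_comm, smul_mul_assoc, hspec, mul_smul_comm, mul_one,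
    smul_mul_assoc, hU, ← hax]
  push_cast
  module

theorem matLog2_smul_idempotent_add {P : Matrix n n ℂ} (hP : P * P = P) (hPH : P.IsHermitian)
    (x y : ℝ) :
    matLog2 ((x : ℂ) • P + (y : ℂ) • (1 : Matrix n n ℂ)) =
      ((Real.logb 2 (x + y) - Real.logb 2 y : ℝ) : ℂ) • P +
        (Real.logb 2 y : ℂ) • (1 : Matrix n n ℂ) := by
  rw [matLog2, dif_pos (isHermitian_real_smul_add hPH x y)]
  exact conj_diagonal_smul_idempotent_add hP x y _ (Real.logb 2)

theorem vnEntropy_smul_idempotent_add {P : Matrix n n ℂ} (hP : P * P = P) (hPH : P.IsHermitian)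
    (x y r : ℝ) (hr : P.trace = r) :
    vnEntropy ((x : ℂ) • P + (y : ℂ) • (1 : Matrix n n ℂ)) =
      -(r * ((x + y) * Real.logb 2 (x + y)) +
        (Fintype.card n - r) * (y * Real.logb 2 y)) := by
  have h := isHermitian_real_smul_add hPH x y
  rw [vnEntropy, dif_pos h]
  congr 1
  have ht := congrArg trace
    (conj_diagonal_smul_idempotent_add hP x y h fun t => t * Real.logb 2 t)
  rw [trace_mul_comm, ← mul_assoc, Unitary.coe_star_mul_self, one_mul, trace_diagonal] at ht
  simp only [trace_add, trace_smul, hr, trace_one, smul_eq_mul] at ht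
  have ht' : ∑ i, h.eigenvalues i * Real.logb 2 (h.eigenvalues i) =
      ((x + y) * Real.logb 2 (x + y) - y * Real.logb 2 y) * r +
        y * Real.logb 2 y * Fintype.card n := by
    exact_mod_cast ht
  rw [ht']
  ring

theorem phiPlusProj3_mul_self : phiPlusProj3 * phiPlusProj3 = phiPlusProj3 := by
  ext ⟨i, j⟩ ⟨k, l⟩
  fin_cases i <;> fin_cases j <;> fin_cases k <;> fin_cases l <;>
    simp [phiPlusProj3, mul_apply, Fintype.sum_prod_type]

theorem phiPlusProj3_isHermitian : phiPlusProj3.IsHermitian := by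
  ext p q
  simp [phiPlusProj3, conjTranspose_apply, apply_ite, and_comm]

theorem phiPlusProj3_trace : phiPlusProj3.trace = 1 := by
  simp [phiPlusProj3, trace, Fintype.sum_prod_type]

theorem rhoIso3_eq : rhoIso3 = ((4 / 5 : ℝ) : ℂ) • phiPlusProj3 + ((1 / 45 : ℝ) : ℂ) • 1 := by
  rw [rhoIso3, smul_smul]
  norm_num

theorem rhoT3_eq :
    rhoT3 = ((143 / 200 : ℝ) : ℂ) • phiPlusProj3 + ((19 / 600 : ℝ) : ℂ) • 1 := by
  rw [rhoT3, smul_smul]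
  norm_num

theorem ptraceB_rhoT3 : ptraceB rhoT3 = ((0 : ℝ) : ℂ) • 0 + ((1 / 3 : ℝ) : ℂ) • 1 := by
  rw [rhoT3_eq]
  ext k l
  fin_cases k <;> fin_cases l <;>
    simp [ptraceB, phiPlusProj3, Fin.sum_univ_three, one_apply] <;> norm_num

theorem condEntropy_rhoT3_neg : condEntropy rhoT3 < 0 := by
  have hS := vnEntropy_smul_idempotent_add phiPlusProj3_mul_self phiPlusProj3_isHermitian
    (143 / 200) (19 / 600) 1 (by rw [phiPlusProj3_trace]; simp)
  have hB := vnEntropy_smul_idempotent_add (n := Fin 3) (mul_zero 0) isHermitian_zero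
    0 (1 / 3) 0 (by simp)
  rw [condEntropy, ptraceB_rhoT3, rhoT3_eq, hS, hB]
  have key : Real.logb 2 ((75 / 56) ^ 56 * (600 / 19) ^ 19) < Real.logb 2 (3 ^ 75) :=
    Real.logb_lt_logb (by norm_num) (by positivity) (by norm_num)
  rw [Real.logb_mul (by positivity) (by positivity), Real.logb_pow, Real.logb_pow,
    Real.logb_pow] at key
  have h1 : Real.logb 2 (143 / 200 + 19 / 600) = -Real.logb 2 (75 / 56) := by
    rw [← Real.logb_inv]; norm_num
  have h2 : Real.logb 2 (19 / 600) = -Real.logb 2 (600 / 19) := by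
    rw [← Real.logb_inv]; norm_num
  have h3 : Real.logb 2 (1 / 3) = -Real.logb 2 3 := by
    rw [← Real.logb_inv]; norm_num
  rw [h1, h2, zero_add, h3]
  norm_num at key ⊢
  linarith

theorem trace_witness3_mul_rhoT3_pos : 0 < ((witness3 * rhoT3).trace).re := by
  have key : Real.logb 2 (3 ^ 75) < Real.logb 2 ((45 / 37) ^ 56 * 45 ^ 19) :=
    Real.logb_lt_logb (by norm_num) (by positivity) (by norm_num)
  rw [Real.logb_mul (by positivity) (by positivity), Real.logb_pow, Real.logb_pow,
    Real.logb_pow] at key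
  have h1 : Real.logb 2 (4 / 5 + 1 / 45) = -Real.logb 2 (45 / 37) := by
    rw [← Real.logb_inv]; norm_num
  have h2 : Real.logb 2 (1 / 45) = -Real.logb 2 45 := by
    rw [← Real.logb_inv]; norm_num
  have htr : (witness3 * rhoT3).trace =
      ((56 / 75 * Real.logb 2 (45 / 37) + 19 / 75 * Real.logb 2 45 - Real.logb 2 3 : ℝ) : ℂ) := by
    rw [witness3, rhoIso3_eq,
      matLog2_smul_idempotent_add phiPlusProj3_mul_self phiPlusProj3_isHermitian, rhoT3_eq, h1, h2]
    simp only [sub_mul, neg_mul, add_mul, mul_add, smul_mul_assoc, mul_smul_comm, mul_one, one_mul,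
      phiPlusProj3_mul_self, trace_sub, trace_neg, trace_add, trace_smul, phiPlusProj3_trace,
      trace_one, smul_eq_mul, Fintype.card_prod, Fintype.card_fin]
    push_cast
    ring
  rw [htr, Complex.ofReal_re]
  norm_num at key ⊢
  linarith

/-- the witness is not universal: `ρ_t` has negative conditional entropy
but `Tr(W·ρ_t) > 0`. -/
theorem witness_not_universal :
    condEntropy rhoT3 < 0 ∧ 0 < ((witness3 * rhoT3).trace).re :=
  ⟨condEntropy_rhoT3_neg, trace_witness3_mul_rhoT3_pos⟩
end
end
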